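/- Let 𝕋 be an almost periodic time scale (Π ≠ {0}) with bounded graininess sup_{t∈𝕋} μ(t) < ∞. Consider the delayed cellular neural network x_i^Δ(t) = −c_i(t)x_i(t) + Σ_{j=1}^n a_{ij}(t) f_j(x_j(t)) + Σ_{j=1}^n b_{ij}(t) f_j(x_j(t − γ_{ij})) + I_i(t), t ∈ 𝕋, i = 1,...,n, under hypotheses (H1)–(H3) and (H5) of the context, and assume additionally that each input I_i belongs to AP(𝕋,ℝ). Then the system has a unique solution in E := {φ ∈ AP(𝕋,ℝⁿ) : ‖φ‖_∞ ≤ r₀}, i.e. a unique almost periodic solution in E. -/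

import Mathlib

open MeasureTheory Filter Set

noncomputable section

/-- Forward jump operator of a time scale `T`. -/
def tsSigma (T : Set ℝ) (t : ℝ) : ℝ := sInf {s | s ∈ T ∧ t < s}

/-- Graininess of a time scale. -/
def tsGrain (T : Set ℝ) (t : ℝ) : ℝ := tsSigma T t - t

/-- The set `Π` of translation numbers of a time scale. -/
def tsPi (T : Set ℝ) : Set ℝ := {τ : ℝ | ∀ t ∈ T, t + τ ∈ T ∧ t - τ ∈ T}

/-- An almost periodic time scale: a nonempty closed subset of `ℝ` with `Π ≠ {0}`. -/
def APTimeScale (T : Set ℝ) : Prop :=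
  T.Nonempty ∧ IsClosed T ∧ ∃ τ ∈ tsPi T, τ ≠ 0

/-- The Δ-measure of the time scale `T`:
Lebesgue measure restricted to `T` plus point masses `μ(t)·δ_t` at right-scattered points. -/
def deltaMeasure (T : Set ℝ) : Measure ℝ :=
  volume.restrict T +
    Measure.sum (fun p : {t : ℝ // t ∈ T ∧ t < tsSigma T t} =>
      (ENNReal.ofReal (tsGrain T p.1)) • Measure.dirac (p.1 : ℝ))

/-- The integrand `g_a` appearing in the generalized exponential function. -/
def gExp (T : Set ℝ) (a : ℝ) (τ : ℝ) : ℝ :=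
  if 0 < tsGrain T τ then Real.log (1 + tsGrain T τ * a) / tsGrain T τ else a

/-- The generalized exponential function `e_{⊖a}(t, s)` (intended for `s ≤ t`). -/
def eOminus (T : Set ℝ) (a t s : ℝ) : ℝ :=
  Real.exp (-∫ τ in Ico s t ∩ T, gExp T a τ ∂(deltaMeasure T))

/-- `t̄ = min([0,∞) ∩ T)`. -/
def tsT0 (T : Set ℝ) : ℝ := sInf {t : ℝ | t ∈ T ∧ 0 ≤ t}

/-- `Q_r = [t̄ - r, t̄ + r] ∩ T`. -/
def Qr (T : Set ℝ) (r : ℝ) : Set ℝ := Icc (tsT0 T - r) (tsT0 T + r) ∩ T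

/-- `u(Q_r) = ∫_{Q_r} u dμ_Δ`. -/
def uQ (T : Set ℝ) (u : ℝ → ℝ) (r : ℝ) : ℝ := ∫ t in Qr T r, u t ∂(deltaMeasure T)

/-- The filter `r → ∞` along `Π`. -/
def alongPi (T : Set ℝ) : Filter ℝ := atTop ⊓ 𝓟 (tsPi T)

/-- The filter `|t| → ∞`, `t ∈ T`. -/
def absAtTopIn (T : Set ℝ) : Filter ℝ := (atTop ⊔ atBot) ⊓ 𝓟 T

/-- The class `U_∞` of admissible weights on the time scale `T`. -/
def UInfty (T : Set ℝ) (u : ℝ → ℝ) : Prop :=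
  Measurable u ∧ (∀ t ∈ T, 0 < u t) ∧
  (∀ s : Set ℝ, Bornology.IsBounded s → IntegrableOn u (s ∩ T) (deltaMeasure T)) ∧
  (∃ c > 0, ∀ t ∈ T, c ≤ u t) ∧
  Tendsto (uQ T u) (alongPi T) atTop

/-- The class `U_∞^Inv` of weights:
`limsup_{|t|→∞, t∈T} u(t+s)/u(t) < ∞` for every `s ∈ Π`. -/
def UInftyInv (T : Set ℝ) (u : ℝ → ℝ) : Prop :=
  UInfty T u ∧ ∀ s ∈ tsPi T, ∃ C : ℝ, ∀ᶠ t in absAtTopIn T, u (t + s) / u t ≤ C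

variable {E : Type*} [NormedAddCommGroup E]

/-- Almost periodic functions on a time scale (Bohr-type definition via `Π`). -/
def APfun (T : Set ℝ) (f : ℝ → E) : Prop :=
  ContinuousOn f T ∧
  ∀ ε > 0, ∃ l > 0, ∀ x : ℝ, ∃ τ ∈ tsPi T, τ ∈ Icc x (x + l) ∧
    ∀ t ∈ T, ‖f (t + τ) - f t‖ < ε

/-- Bounded continuous functions on the time scale `T`. -/
def BCfun (T : Set ℝ) (f : ℝ → E) : Prop :=
  ContinuousOn f T ∧ ∃ C : ℝ, ∀ t ∈ T, ‖f t‖ ≤ C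

/-- The weighted ergodic space `PAP₀(T, E, u)`. -/
def PAP0fun (T : Set ℝ) (u : ℝ → ℝ) (f : ℝ → E) : Prop :=
  BCfun T f ∧
  Tendsto (fun r => (uQ T u r)⁻¹ * ∫ t in Qr T r, ‖f t‖ * u t ∂(deltaMeasure T))
    (alongPi T) (nhds 0)

/-- Weighted pseudo-almost periodic functions on the time scale `T`. -/
def PAPfun (T : Set ℝ) (u : ℝ → ℝ) (f : ℝ → E) : Prop :=
  ∃ g h : ℝ → E, APfun T g ∧ PAP0fun T u h ∧ ∀ t ∈ T, f t = g t + h t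

/-- `d` is the Δ-derivative of `f` at `t ∈ T`. -/
def deltaDeriv [NormedSpace ℝ E] (T : Set ℝ) (f : ℝ → E) (t : ℝ) (d : E) : Prop :=
  ∀ ε > 0, ∃ δ > 0, ∀ s ∈ T, |s - t| < δ →
    ‖f (tsSigma T t) - f s - (tsSigma T t - s) • d‖ ≤ ε * |tsSigma T t - s|

/-- A fixed matrix norm (the ℓ¹ norm of the entries). -/
def matNorm {n : ℕ} (M : Matrix (Fin n) (Fin n) ℝ) : ℝ := ∑ i, ∑ j, |M i j|

/-- The linear system `x^Δ = A(t) x` admits an exponential dichotomy on `T`. -/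
def ExpDichotomy {n : ℕ} (T : Set ℝ) (A : ℝ → Matrix (Fin n) (Fin n) ℝ) : Prop :=
  ∃ K > (0 : ℝ), ∃ α > (0 : ℝ), ∃ P : Matrix (Fin n) (Fin n) ℝ, P * P = P ∧
    ∃ X : ℝ → Matrix (Fin n) (Fin n) ℝ,
      (∀ t ∈ T, IsUnit (X t)) ∧
      (∀ t ∈ T, ∀ i j, deltaDeriv T (fun s => X s i j) t ((A t * X t) i j)) ∧
      (∀ s ∈ T, ∀ t ∈ T, tsSigma T s ≤ t →
        matNorm (X t * P * (X (tsSigma T s))⁻¹) ≤ K * eOminus T α t (tsSigma T s)) ∧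
      (∀ s ∈ T, ∀ t ∈ T, t ≤ tsSigma T s →
        matNorm (X t * (1 - P) * (X (tsSigma T s))⁻¹) ≤ K * eOminus T α (tsSigma T s) t)

/-- `x` is a bounded continuous solution on `T` of `x^Δ(t) = A(t) x(t) + F(t)`. -/
def IsLinBddSol {n : ℕ} (T : Set ℝ) (A : ℝ → Matrix (Fin n) (Fin n) ℝ)
    (F x : ℝ → Fin n → ℝ) : Prop :=
  BCfun T x ∧ ∀ t ∈ T, deltaDeriv T x t ((A t).mulVec (x t) + F t)

/-- `x` is a (continuous, Δ-differentiable) solution of the delayed cellular neural network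
on the set `S ⊆ T`. -/
def IsCNNSol {n : ℕ} (T S : Set ℝ) (c : Fin n → ℝ → ℝ) (a b : Fin n → Fin n → ℝ → ℝ)
    (f : Fin n → ℝ → ℝ) (γ : Fin n → Fin n → ℝ) (I : Fin n → ℝ → ℝ)
    (x : ℝ → Fin n → ℝ) : Prop :=
  ContinuousOn x T ∧
  ∀ t ∈ S, ∀ i, deltaDeriv T (fun s => x s i) t
    (-(c i t) * x t i + (∑ j, a i j t * f j (x t j)) +
      (∑ j, b i j t * f j (x (t - γ i j) j)) + I i t)

end

/-! ### Basic facts on time scales -/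

lemma ts_unbdd {T : Set ℝ} (hT : APTimeScale T) :
    ∃ h > 0, h ∈ tsPi T ∧ ∀ k : ℤ, (k : ℝ) * h ∈ tsPi T := by
  obtain ⟨_, _, τ, hτ, hne⟩ := hT
  have hneg : -τ ∈ tsPi T := fun t ht => by
    have := hτ t ht
    refine ⟨by simpa [sub_eq_add_neg] using this.2, by simpa using this.1⟩
  have habs : |τ| ∈ tsPi T := by
    rcases abs_choice τ with h | h <;> rw [h] <;> assumption
  refine ⟨|τ|, abs_pos.mpr hne, habs, ?_⟩
  have hn : ∀ k : ℕ, ∀ t ∈ T, t + k * |τ| ∈ T ∧ t - k * |τ| ∈ T := by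
    intro k
    induction k with
    | zero => intro t ht; simpa using ht
    | succ k ih =>
      intro t ht
      have h1 := (habs _ (ih t ht).1).1
      have h2 := (habs _ (ih t ht).2).2
      refine ⟨?_, ?_⟩
      · convert h1 using 1; push_cast; ring
      · convert h2 using 1; push_cast; ring
  intro k t ht
  obtain ⟨m, rfl | rfl⟩ := k.eq_nat_or_neg
  · simpa using hn m t ht
  · have := hn m t ht
    refine ⟨?_, ?_⟩
    · convert this.2 using 1; push_cast; ring
    · convert this.1 using 1; push_cast; ring

lemma tsPi_neg {T : Set ℝ} {τ : ℝ} (h : τ ∈ tsPi T) : -τ ∈ tsPi T := fun t ht =>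
  ⟨by simpa [sub_eq_add_neg] using (h t ht).2, by simpa using (h t ht).1⟩

lemma tsPi_sub {T : Set ℝ} {τ ρ : ℝ} (h : τ ∈ tsPi T) (h' : ρ ∈ tsPi T) : τ - ρ ∈ tsPi T :=
  fun t ht => by
    refine ⟨?_, ?_⟩
    · convert (h' _ (h t ht).1).2 using 1; ring
    · convert (h' _ (h t ht).2).1 using 1; ring

lemma ts_above {T : Set ℝ} (hT : APTimeScale T) (u : ℝ) : ∃ t ∈ T, u < t := by
  obtain ⟨h, hh, _, hk⟩ := ts_unbdd hT
  obtain ⟨t, ht⟩ := hT.1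
  obtain ⟨m, hm⟩ := exists_int_gt ((u - t) / h)
  refine ⟨_, (hk m t ht).1, ?_⟩
  rw [div_lt_iff₀ hh] at hm
  linarith

lemma ts_below {T : Set ℝ} (hT : APTimeScale T) (u : ℝ) : ∃ t ∈ T, t < u := by
  obtain ⟨h, hh, _, hk⟩ := ts_unbdd hT
  obtain ⟨t, ht⟩ := hT.1
  obtain ⟨m, hm⟩ := exists_int_gt ((t - u) / h)
  refine ⟨_, (hk m t ht).2, ?_⟩
  rw [div_lt_iff₀ hh] at hm
  linarith

lemma sigma_bdd (T : Set ℝ) (t : ℝ) : BddBelow {s | s ∈ T ∧ t < s} :=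
  ⟨t, fun _ hs => hs.2.le⟩

lemma sigma_ne {T : Set ℝ} (hT : APTimeScale T) (t : ℝ) : {s | s ∈ T ∧ t < s}.Nonempty := by
  obtain ⟨s, hs, hs'⟩ := ts_above hT t
  exact ⟨s, hs, hs'⟩

lemma sigma_ge {T : Set ℝ} (hT : APTimeScale T) (t : ℝ) : t ≤ tsSigma T t :=
  le_csInf (sigma_ne hT t) fun _ hs => hs.2.le

lemma sigma_le {T : Set ℝ} {t s : ℝ} (hs : s ∈ T) (h : t < s) : tsSigma T t ≤ s :=
  csInf_le (sigma_bdd T t) ⟨hs, h⟩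

lemma sigma_mem {T : Set ℝ} (hT : APTimeScale T) (t : ℝ) : tsSigma T t ∈ T := by
  have h := csInf_mem_closure (sigma_ne hT t) (sigma_bdd T t)
  have h2 : closure {s | s ∈ T ∧ t < s} ⊆ T := by
    apply closure_minimal (fun s hs => hs.1) hT.2.1
  exact h2 h

lemma sigma_dense {T : Set ℝ} (hT : APTimeScale T) {t u : ℝ} (h : tsSigma T t < u) :
    ∃ s ∈ T, t < s ∧ s < u := by
  obtain ⟨s, hs, hs'⟩ := exists_lt_of_csInf_lt (sigma_ne hT t) h
  exact ⟨s, hs.1, hs.2, hs'⟩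

lemma sigma_shift {T : Set ℝ} (hT : APTimeScale T) {τ : ℝ} (hτ : τ ∈ tsPi T) (t : ℝ) :
    tsSigma T (t + τ) = tsSigma T t + τ := by
  have key : ∀ ρ ∈ tsPi T, ∀ t, tsSigma T (t + ρ) ≤ tsSigma T t + ρ := by
    intro ρ hρ t
    have : tsSigma T (t + ρ) - ρ ≤ tsSigma T t := by
      apply le_csInf (sigma_ne hT t)
      intro s hs
      have := sigma_le (hρ s hs.1).1 (show t + ρ < s + ρ by linarith [hs.2])
      linarith
    linarith
  have h1 := key τ hτ t
  have h2 := key (-τ) (tsPi_neg hτ) (t + τ)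
  simp only [add_neg_cancel_right] at h2
  linarith

lemma deltaDeriv_sigma {T : Set ℝ} {v : ℝ → ℝ} {t d : ℝ} (ht : t ∈ T) (h : deltaDeriv T v t d) :
    v (tsSigma T t) = v t + tsGrain T t * d := by
  have h1 : ∀ ε > 0, |v (tsSigma T t) - v t - (tsSigma T t - t) * d| ≤ ε * |tsSigma T t - t| := by
    intro ε hε
    obtain ⟨δ, hδ, h⟩ := h ε hε
    simpa using h t ht (by simpa using hδ)
  have h2 : |v (tsSigma T t) - v t - (tsSigma T t - t) * d| ≤ 0 := by
    apply le_of_forall_pos_le_add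
    intro e he
    have := h1 (e / (|tsSigma T t - t| + 1)) (by positivity)
    refine this.trans ?_
    rw [zero_add, div_mul_eq_mul_div, div_le_iff₀ (by positivity)]
    nlinarith [abs_nonneg (tsSigma T t - t)]
  have h3 := abs_eq_zero.mp (le_antisymm h2 (abs_nonneg _))
  unfold tsGrain
  linarith

lemma deltaDeriv_sub {T : Set ℝ} {v w : ℝ → ℝ} {t d e : ℝ}
    (h : deltaDeriv T v t d) (h' : deltaDeriv T w t e) :
    deltaDeriv T (fun s => v s - w s) t (d - e) := by
  intro ε hε
  obtain ⟨δ, hδ, h⟩ := h (ε / 2) (by positivity)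
  obtain ⟨δ', hδ', h'⟩ := h' (ε / 2) (by positivity)
  refine ⟨min δ δ', lt_min hδ hδ', fun s hs hst => ?_⟩
  have h1 := h s hs (hst.trans_le (min_le_left _ _))
  have h2 := h' s hs (hst.trans_le (min_le_right _ _))
  have := norm_sub_le_of_le h1 h2
  convert this using 1
  · congr 1; simp only [smul_eq_mul]; ring
  · ring

lemma deltaDeriv_neg {T : Set ℝ} {v : ℝ → ℝ} {t d : ℝ}
    (h : deltaDeriv T v t d) : deltaDeriv T (fun s => - v s) t (-d) := by
  intro ε hε
  obtain ⟨δ, hδ, h⟩ := h ε hε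
  refine ⟨δ, hδ, fun s hs hst => ?_⟩
  have h1 := h s hs hst
  have e : - v (tsSigma T t) - - v s - (tsSigma T t - s) • (-d)
      = -(v (tsSigma T t) - v s - (tsSigma T t - s) • d) := by
    simp only [smul_eq_mul]
    ring
  rw [e, norm_neg]
  exact h1

lemma deltaDeriv_shift {T : Set ℝ} (hT : APTimeScale T) {τ : ℝ} (hτ : τ ∈ tsPi T)
    {v : ℝ → ℝ} {t d : ℝ}
    (h : deltaDeriv T v (t + τ) d) : deltaDeriv T (fun s => v (s + τ)) t d := by
  intro ε hε
  obtain ⟨δ, hδ, h⟩ := h ε hε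
  refine ⟨δ, hδ, fun s hs hst => ?_⟩
  have h1 := h (s + τ) (hτ s hs).1 (by simpa using hst)
  rw [sigma_shift hT hτ] at h1
  simpa using h1

/-- Comparison principle. -/
lemma ts_compare {ι : Type*} [Finite ι] {T : Set ℝ} (hT : APTimeScale T) {t0 : ℝ} (ht0 : t0 ∈ T)
    (v d : ι → ℝ → ℝ) (B B' : ℝ → ℝ) (hB : ∀ t, HasDerivAt B (B' t) t)
    (hv : ∀ i, ContinuousOn (v i) T)
    (hd : ∀ i, ∀ t ∈ T, t0 ≤ t → deltaDeriv T (v i) t (d i t))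
    (h0 : ∀ i, v i t0 ≤ B t0)
    (h1 : ∀ i, ∀ t ∈ T, t0 ≤ t → (∀ j, ∀ s ∈ T, t0 ≤ s → s ≤ t → v j s ≤ B s) →
      v i t = B t → d i t < B' t)
    (h2 : ∀ i, ∀ t ∈ T, t0 ≤ t → (∀ j, ∀ s ∈ T, t0 ≤ s → s ≤ t → v j s ≤ B s) →
      v i t + tsGrain T t * d i t ≤ B (tsSigma T t)) :
    ∀ i, ∀ t ∈ T, t0 ≤ t → v i t ≤ B t := by
  have hBc : Continuous B := continuous_iff_continuousAt.mpr fun t => (hB t).continuousAt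
  intro i0 t1 ht1 ht01
  by_contra hcon
  set A : Set ℝ := {t | t ∈ T ∧ t0 ≤ t ∧ t ≤ t1 ∧ ∀ j, ∀ s ∈ T, t0 ≤ s → s ≤ t → v j s ≤ B s}
    with hA
  have hAne : A.Nonempty := ⟨t0, ht0, le_rfl, ht01, fun j s _ h h' => by
    rw [le_antisymm h' h]; exact h0 j⟩
  have hAb : BddAbove A := ⟨t1, fun t ht => ht.2.2.1⟩
  set q := sSup A with hq
  have hqc : q ∈ closure A := csSup_mem_closure hAne hAb
  have hqT : q ∈ T := closure_minimal (fun s hs => hs.1) hT.2.1 hqc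
  have hq0 : t0 ≤ q := by
    obtain ⟨s, hs⟩ := hAne
    exact hs.2.1.trans (le_csSup hAb hs)
  have hq1 : q ≤ t1 := csSup_le hAne fun t ht => ht.2.2.1
  have hqv : ∀ j, v j q ≤ B q := by
    intro j
    have hne : (nhdsWithin q A).NeBot := mem_closure_iff_nhdsWithin_neBot.mp hqc
    have e1 : Tendsto (v j) (nhdsWithin q A) (nhds (v j q)) :=
      ((hv j) q hqT).mono_left (nhdsWithin_mono _ fun s hs => hs.1)
    have e2 : Tendsto B (nhdsWithin q A) (nhds (B q)) :=
      (hBc.tendsto q).mono_left nhdsWithin_le_nhds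
    refine le_of_tendsto_of_tendsto e1 e2 ?_
    filter_upwards [self_mem_nhdsWithin] with s hs
    exact hs.2.2.2 j s hs.1 hs.2.1 le_rfl
  have hqall : ∀ j, ∀ s ∈ T, t0 ≤ s → s ≤ q → v j s ≤ B s := by
    intro j s hs hs0 hsq
    rcases hsq.lt_or_eq with h | h
    · obtain ⟨r, hr, hsr⟩ := exists_lt_of_lt_csSup hAne h
      exact hr.2.2.2 j s hs hs0 hsr.le
    · rw [h]; exact hqv j
  have hlt : q < t1 := lt_of_le_of_ne hq1 fun h => hcon (by rw [← h]; exact hqv i0)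
  rcases (sigma_ge hT q).lt_or_eq with hsc | hden
  · -- right-scattered
    have hmem : tsSigma T q ∈ A := by
      refine ⟨sigma_mem hT q, hq0.trans hsc.le, sigma_le ht1 hlt, fun j s hs hs0 hsq => ?_⟩
      by_cases h : s ≤ q
      · exact hqall j s hs hs0 h
      · push Not at h
        have := sigma_le hs h
        rw [le_antisymm hsq this, deltaDeriv_sigma hqT (hd j q hqT hq0)]
        exact h2 j q hqT hq0 hqall
    exact absurd (le_csSup hAb hmem) (not_le.mpr hsc)
  · -- right-dense
    have hev : ∀ j, ∃ δ > 0, ∀ s ∈ T, q < s → s < q + δ → v j s ≤ B s := by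
      intro j
      rcases (hqv j).lt_or_eq with h | h
      · have e1 : ∀ᶠ s in nhdsWithin q T, v j s < B s :=
          ((hv j) q hqT).eventually_lt (hBc.continuousWithinAt) h
        rw [eventually_nhdsWithin_iff, Metric.eventually_nhds_iff] at e1
        obtain ⟨δ, hδ, h⟩ := e1
        refine ⟨δ, hδ, fun s hs h3 h4 => (h ?_ hs).le⟩
        rw [Real.dist_eq, abs_lt]; constructor <;> linarith
      · have hlt := h1 j q hqT hq0 hqall h
        set e := (B' q - d j q) / 2 with he
        have hepos : 0 < e := by simp only [he]; linarith
        obtain ⟨δ, hδ, hδ'⟩ := hd j q hqT hq0 e hepos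
        have hb := (hasDerivAt_iff_isLittleO.mp (hB q)).def hepos
        rw [Metric.eventually_nhds_iff] at hb
        obtain ⟨δ2, hδ2, hb⟩ := hb
        refine ⟨min δ δ2, lt_min hδ hδ2, fun s hs h3 h4 => ?_⟩
        have h5 : s - q < δ := by linarith [min_le_left δ δ2]
        have h6 : s - q < δ2 := by linarith [min_le_right δ δ2]
        have h7 : |s - q| = s - q := abs_of_pos (by linarith)
        have k1 := hδ' s hs (by rw [h7]; exact h5)
        have k2 := hb (show dist s q < δ2 by rw [Real.dist_eq, h7]; exact h6)
        rw [← hden] at k1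
        simp only [smul_eq_mul, Real.norm_eq_abs] at k1 k2
        rw [abs_sub_comm q s, h7] at k1
        rw [h7] at k2
        have k3 := (abs_le.mp k1).1
        have k4 := (abs_le.mp k2).1
        have : e * (s - q) * 2 = (B' q - d j q) * (s - q) := by simp only [he]; ring
        nlinarith
    choose δ hδ hδ' using hev
    obtain ⟨η, hη, hηδ⟩ : ∃ η > 0, ∀ j, η ≤ δ j := by
      have hf : (Set.range δ).Finite := Set.finite_range δ
      by_cases hι : Nonempty ι
      · obtain ⟨j, hj⟩ := Finite.exists_min δ
        exact ⟨δ j, hδ j, hj⟩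
      · exact ⟨1, one_pos, fun j => (hι ⟨j⟩).elim⟩
    obtain ⟨s, hs, hqs, hs'⟩ := sigma_dense hT (t := q) (u := min t1 (q + η))
      (by rw [← hden]; exact lt_min hlt (by linarith))
    have hmem : s ∈ A := by
      refine ⟨hs, hq0.trans hqs.le, (hs'.trans_le (min_le_left _ _)).le, fun j r hr hr0 hrs => ?_⟩
      by_cases h : r ≤ q
      · exact hqall j r hr hr0 h
      · push Not at h
        refine hδ' j r hr h ?_
        have := hs'.trans_le (min_le_right _ _)
        linarith [hηδ j]
    exact absurd (le_csSup hAb hmem) (not_le.mpr hqs)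

/-- A priori bound for bounded entire solutions of scalar linear equations. -/
lemma ts_maxprin {T : Set ℝ} (hT : APTimeScale T) (x c g : ℝ → ℝ) (c0 K M : ℝ) (hc0 : 0 < c0)
    (hx : ContinuousOn x T) (hM : ∀ t ∈ T, |x t| ≤ M) (hc : ∀ t ∈ T, c0 ≤ c t)
    (hreg : ∀ t ∈ T, 0 < 1 - tsGrain T t * c t) (hK : 0 ≤ K)
    (hg : ∀ t ∈ T, |g t| ≤ K * c0)
    (hd : ∀ t ∈ T, deltaDeriv T x t (-(c t) * x t + g t)) :
    ∀ t ∈ T, |x t| ≤ K := by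
  -- one-sided version
  have key : ∀ (x g : ℝ → ℝ), ContinuousOn x T → (∀ t ∈ T, |x t| ≤ M) →
      (∀ t ∈ T, |g t| ≤ K * c0) → (∀ t ∈ T, deltaDeriv T x t (-(c t) * x t + g t)) →
      ∀ t ∈ T, x t ≤ K := by
    intro x g hx hM hg hd t ht
    set A := max M 1 with hAdef
    have hA : 0 < A := lt_max_of_lt_right one_pos
    set lam := c0 / 2 with hlam
    have hlam0 : 0 < lam := by positivity
    have est : ∀ s ∈ T, s ≤ t → x t ≤ K + A * Real.exp (-lam * (t - s)) := by
      intro s hs hst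
      have hB : ∀ r, HasDerivAt (fun r => K + A * Real.exp (-lam * (r - s)))
          (A * (Real.exp (-lam * (r - s)) * (-lam))) r := by
        intro r
        have h1 : HasDerivAt (fun r => -lam * (r - s)) (-lam) r := by
          simpa using ((hasDerivAt_id r).sub_const s).const_mul (-lam)
        exact ((h1.exp).const_mul A).const_add K
      refine ts_compare (ι := Unit) hT hs (fun _ => x) (fun _ t => -(c t) * x t + g t)
        _ _ hB (fun _ => hx) (fun _ t ht _ => hd t ht) ?_ ?_ ?_ () t ht hst
      · intro _
        have := (abs_le.mp (hM s hs)).2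
        have h2 : M ≤ A := le_max_left _ _
        simp
        linarith
      · intro _ r hr hsr _ heq
        rw [heq]
        have hE := Real.exp_pos (-lam * (r - s))
        set e := Real.exp (-lam * (r - s))
        have h1 := (abs_le.mp (hg r hr)).2
        have h2 := hc r hr
        have h3 : 0 < A * e := by positivity
        have h4 : c r * (K + A * e) ≥ c0 * (K + A * e) := by
          apply mul_le_mul_of_nonneg_right h2; positivity
        have h5 : A * (e * -lam) = - (c0 / 2) * (A * e) := by rw [hlam]; ring
        rw [h5]
        nlinarith
      · intro _ r hr hsr hall
        have hxr := hall () r hr hsr le_rfl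
        have hmu : 0 ≤ tsGrain T r := by unfold tsGrain; linarith [sigma_ge hT r]
        have hE := Real.exp_pos (-lam * (r - s))
        have hexp : Real.exp (-lam * (tsSigma T r - s))
            = Real.exp (-lam * (r - s)) * Real.exp (-lam * tsGrain T r) := by
          rw [← Real.exp_add]; congr 1; unfold tsGrain; ring
        rw [hexp]
        have h6 := Real.add_one_le_exp (-lam * tsGrain T r)
        set e := Real.exp (-lam * (r - s))
        set e2 := Real.exp (-lam * tsGrain T r)
        set m := tsGrain T r
        have h1 := (abs_le.mp (hg r hr)).2
        have h2 := hc r hr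
        have h3 : 0 < A * e := by positivity
        have h4 := hreg r hr
        have h7 : (1 - m * c r) * x r ≤ (1 - m * c r) * (K + A * e) :=
          mul_le_mul_of_nonneg_left hxr h4.le
        have h8 : m * g r ≤ m * (K * c0) := mul_le_mul_of_nonneg_left h1 hmu
        have h9 : m * c0 * (K + A * e) ≤ m * c r * (K + A * e) :=
          mul_le_mul_of_nonneg_right (mul_le_mul_of_nonneg_left h2 hmu) (by positivity)
        have h10 : (1 - m * c0) ≤ e2 := by
          have : lam * m ≤ m * c0 := by rw [hlam]; nlinarith
          linarith
        have h11 : (1 - m * c0) * (A * e) ≤ e2 * (A * e) :=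
          mul_le_mul_of_nonneg_right h10 h3.le
        nlinarith
    apply le_of_forall_pos_le_add
    intro ε hε
    have htend : Tendsto (fun y => A * Real.exp (-lam * y)) atTop (nhds (A * 0)) := by
      apply Tendsto.const_mul
      apply Real.tendsto_exp_atBot.comp
      exact tendsto_id.const_mul_atTop_of_neg (by linarith)
    rw [mul_zero] at htend
    obtain ⟨Y, hY⟩ := ((htend.eventually (gt_mem_nhds hε)).exists_forall_of_atTop)
    obtain ⟨s, hs, hs'⟩ := ts_below hT (min t (t - Y))
    have h1 := hs'.trans_le (min_le_left _ _)
    have h2 := hs'.trans_le (min_le_right _ _)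
    have := est s hs h1.le
    have h3 := hY (t - s) (by linarith)
    linarith
  intro t ht
  rw [abs_le]
  refine ⟨?_, key x g hx hM hg hd t ht⟩
  have := key (fun t => - x t) (fun t => - g t) hx.neg (by simpa using hM) (by simpa using hg)
    (fun t ht => by
      have := deltaDeriv_neg (hd t ht)
      convert this using 1; ring) t ht
  linarith

/-! ### Almost periodic functions -/

lemma ap_core {T : Set ℝ} (hT : APTimeScale T) {f : ℝ → ℝ} (hf : APfun T f) :
    ∀ ε > 0, ∃ K : Set ℝ, IsCompact K ∧ K ⊆ T ∧
      ∀ t ∈ T, ∃ τ : ℝ, (∀ s ∈ T, |s - t| < 1 → s + τ ∈ K ∧ |f (s + τ) - f s| < ε) := by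
  intro ε hε
  obtain ⟨l, hl, h⟩ := hf.2 ε hε
  refine ⟨Icc (-1) (l + 1) ∩ T, isCompact_Icc.inter_right hT.2.1, inter_subset_right, ?_⟩
  intro t ht
  obtain ⟨τ, hτ, hτ', h⟩ := h (-t)
  refine ⟨τ, fun s hs hst => ⟨⟨?_, (hτ s hs).1⟩, h s hs⟩⟩
  have := abs_lt.mp hst
  constructor <;> linarith [hτ'.1, hτ'.2]

lemma ap_bdd {T : Set ℝ} (hT : APTimeScale T) {f : ℝ → ℝ} (hf : APfun T f) :
    ∃ C, 0 ≤ C ∧ ∀ t ∈ T, |f t| ≤ C := by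
  obtain ⟨K, hK, hKT, h⟩ := ap_core hT hf 1 one_pos
  obtain ⟨C, hC⟩ := hK.exists_bound_of_continuousOn (hf.1.mono hKT)
  refine ⟨|C| + 1, by positivity, fun t ht => ?_⟩
  obtain ⟨τ, hτ⟩ := h t ht
  obtain ⟨h1, h2⟩ := hτ t ht (by simp)
  have h3 := hC _ h1
  rw [Real.norm_eq_abs] at h3
  have h4 : |f t| ≤ |f (t + τ)| + |f (t + τ) - f t| := by
    have := abs_sub_abs_le_abs_sub (f t) (f (t + τ))
    rw [abs_sub_comm] at this
    linarith
  linarith [le_abs_self C]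

lemma ap_unif {T : Set ℝ} (hT : APTimeScale T) {f : ℝ → ℝ} (hf : APfun T f) :
    ∀ ε > 0, ∃ δ > 0, ∀ t ∈ T, ∀ s ∈ T, |s - t| < δ → |f s - f t| < ε := by
  intro ε hε
  obtain ⟨K, hK, hKT, h⟩ := ap_core hT hf (ε / 3) (by positivity)
  have hu := hK.uniformContinuousOn_of_continuous (hf.1.mono hKT)
  rw [Metric.uniformContinuousOn_iff] at hu
  obtain ⟨δ, hδ, hu⟩ := hu (ε / 3) (by positivity)
  refine ⟨min δ 1, lt_min hδ one_pos, fun t ht s hs hst => ?_⟩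
  obtain ⟨τ, hτ⟩ := h t ht
  obtain ⟨a1, a2⟩ := hτ t ht (by simp)
  obtain ⟨b1, b2⟩ := hτ s hs (hst.trans_le (min_le_right _ _))
  have h3 := hu _ b1 _ a1 (by rw [Real.dist_eq]; simpa using hst.trans_le (min_le_left _ _))
  rw [Real.dist_eq] at h3
  rw [abs_lt] at *
  constructor <;> linarith [a2.1, a2.2, b2.1, b2.2, h3.1, h3.2]

lemma ap_normal {T : Set ℝ} (hT : APTimeScale T) {f : ℝ → ℝ} (hf : APfun T f) :
    ∀ ε > 0, ∃ S : Set ℝ, S.Finite ∧ S ⊆ tsPi T ∧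
      ∀ p ∈ tsPi T, ∃ s ∈ S, ∀ t ∈ T, |f (t + p) - f (t + s)| < ε := by
  intro ε hε
  obtain ⟨l, hl, h⟩ := hf.2 (ε / 2) (by positivity)
  obtain ⟨δ, hδ, hu⟩ := ap_unif hT hf (ε / 2) (by positivity)
  have htb : TotallyBounded (Icc (0 : ℝ) l ∩ tsPi T) :=
    isCompact_Icc.totallyBounded.subset inter_subset_left
  obtain ⟨S, hS, hSf, hcov⟩ := totallyBounded_iff_subset.mp htb _ (Metric.dist_mem_uniformity hδ)
  refine ⟨S, hSf, fun s hs => (hS hs).2, fun p hp => ?_⟩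
  obtain ⟨τ, hτ, hτ', hf'⟩ := h (p - l)
  have hq : p - τ ∈ Icc (0 : ℝ) l ∩ tsPi T :=
    ⟨⟨by linarith [hτ'.2], by linarith [hτ'.1]⟩, tsPi_sub hp hτ⟩
  obtain ⟨s, hs, hqs⟩ := mem_iUnion₂.mp (hcov hq)
  simp only [mem_ofPred_eq, Real.dist_eq] at hqs
  refine ⟨s, hs, fun t ht => ?_⟩
  have h1 := hf' (t + (p - τ)) (hq.2 t ht).1
  have h2 := hu (t + s) ((hS hs).2 t ht).1 (t + (p - τ)) (hq.2 t ht).1 (by simpa using hqs)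
  rw [Real.norm_eq_abs, show t + (p - τ) + τ = t + p by ring] at h1
  rw [abs_lt] at *
  constructor <;> linarith [h1.1, h1.2, h2.1, h2.2]

/-- Common almost periods for finitely many almost periodic functions. -/
lemma ap_joint {ι : Type*} [Finite ι] {T : Set ℝ} (hT : APTimeScale T) {g : ι → ℝ → ℝ}
    (hg : ∀ i, APfun T (g i)) :
    ∀ ε > 0, ∃ l > 0, ∀ x : ℝ, ∃ τ ∈ tsPi T, τ ∈ Icc x (x + l) ∧
      ∀ i, ∀ t ∈ T, |g i (t + τ) - g i t| < ε := by
  intro ε hε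
  have hN := fun i => ap_normal hT (hg i) (ε / 2) (by positivity)
  choose S hSf hS hcl using hN
  -- code of a translation
  have hcode : ∀ p : tsPi T, ∃ k : (i : ι) → S i, ∀ i, ∀ t ∈ T,
      |g i (t + p) - g i (t + k i)| < ε / 2 := by
    intro p
    choose k hk hk' using fun i => hcl i p p.2
    exact ⟨fun i => ⟨k i, hk i⟩, hk'⟩
  choose k hk using hcode
  have : ∀ i, Finite (S i) := fun i => (hSf i).to_subtype
  have hfin : (Set.range k).Finite := Set.toFinite _
  have hrep : ∀ y : Set.range k, ∃ q : tsPi T, k q = y := fun y => y.2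
  choose q hq using hrep
  have : Finite (Set.range k) := hfin.to_subtype
  obtain ⟨R, hR⟩ : ∃ R : ℝ, ∀ y, |(q y : ℝ)| ≤ R := by
    obtain ⟨R, hR⟩ := (Set.finite_range (fun y => |(q y : ℝ)|)).bddAbove
    exact ⟨R, fun y => hR ⟨y, rfl⟩⟩
  obtain ⟨h, hh, _, hmul⟩ := ts_unbdd hT
  refine ⟨2 * |R| + h, by positivity, fun x => ?_⟩
  set m := ⌈(x + |R|) / h⌉ with hm
  have hm1 : x + |R| ≤ m * h := by
    rw [← div_le_iff₀ hh]; exact Int.le_ceil _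
  have hm2 : m * h ≤ x + |R| + h := by
    have := (Int.ceil_lt_add_one ((x + |R|) / h)).le
    have h2 : (m : ℝ) * h ≤ ((x + |R|) / h + 1) * h := mul_le_mul_of_nonneg_right this hh.le
    rw [add_mul, div_mul_cancel₀ _ hh.ne'] at h2
    linarith
  set P : tsPi T := ⟨m * h, hmul m⟩
  set Q := q ⟨k P, P, rfl⟩ with hQ
  have hkQ : k Q = k P := hq _
  have hQR := abs_le.mp ((hR ⟨k P, P, rfl⟩).trans (le_abs_self R))
  refine ⟨m * h - Q, tsPi_sub (hmul m) Q.2, ⟨by linarith [hQR.2], by linarith [hQR.1]⟩, ?_⟩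
  intro i t ht
  have ht' : t - Q ∈ T := (Q.2 t ht).2
  have h1 := hk P i (t - Q) ht'
  have h2 := hk Q i (t - Q) ht'
  rw [hkQ] at h2
  rw [show t - (Q : ℝ) + P = t + (m * h - Q) by simp only [P]; ring] at h1
  rw [sub_add_cancel] at h2
  rw [abs_lt] at *
  constructor <;> linarith [h1.1, h1.2, h2.1, h2.2]

/-! ### Integration on time scales via the left retraction -/

/-- The largest point of `T` that is at most `u`. -/
noncomputable def tsP (T : Set ℝ) (u : ℝ) : ℝ := sSup {s | s ∈ T ∧ s ≤ u}

lemma tsP_ne {T : Set ℝ} (hT : APTimeScale T) (u : ℝ) : {s | s ∈ T ∧ s ≤ u}.Nonempty := by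
  obtain ⟨s, hs, h⟩ := ts_below hT u
  exact ⟨s, hs, h.le⟩

lemma tsP_bdd (T : Set ℝ) (u : ℝ) : BddAbove {s | s ∈ T ∧ s ≤ u} := ⟨u, fun _ hs => hs.2⟩

lemma tsP_le {T : Set ℝ} (hT : APTimeScale T) (u : ℝ) : tsP T u ≤ u :=
  csSup_le (tsP_ne hT u) fun _ hs => hs.2

lemma le_tsP {T : Set ℝ} {s u : ℝ} (hs : s ∈ T) (h : s ≤ u) : s ≤ tsP T u :=
  le_csSup (tsP_bdd T u) ⟨hs, h⟩

lemma tsP_mem {T : Set ℝ} (hT : APTimeScale T) (u : ℝ) : tsP T u ∈ T := by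
  have h := csSup_mem_closure (tsP_ne hT u) (tsP_bdd T u)
  exact closure_minimal (fun s hs => hs.1) hT.2.1 h

lemma tsP_mono {T : Set ℝ} (hT : APTimeScale T) : Monotone (tsP T) := fun u _ huv =>
  le_tsP (tsP_mem hT u) ((tsP_le hT u).trans huv)

lemma tsP_meas {n : ℕ} {T : Set ℝ} (hT : APTimeScale T) {h : ℝ → Fin n → ℝ}
    (hh : ContinuousOn h T) : Measurable (fun u => h (tsP T u)) := by
  have h1 : Measurable (fun u => (⟨tsP T u, tsP_mem hT u⟩ : T)) :=
    (tsP_mono hT).measurable.subtype_mk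
  have h2 : Continuous (T.domRestrict h) := hh.domRestrict
  exact h2.measurable.comp h1

lemma int_est {n : ℕ} {T : Set ℝ} (hT : APTimeScale T) {t δ : ℝ} (hδ : 0 < δ) :
    ∃ δ' > 0, ∀ (h : ℝ → Fin n → ℝ) (ε : ℝ),
      (∀ a b, IntervalIntegrable (fun u => h (tsP T u)) volume a b) →
      (∀ r ∈ T, |r - t| < δ → ‖h r - h t‖ ≤ ε) →
      ∀ s ∈ T, |s - t| < δ' →
        ‖(∫ u in s..tsSigma T t, h (tsP T u)) - (tsSigma T t - s) • h t‖
          ≤ ε * |tsSigma T t - s| := by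
  obtain ⟨δ', hδ', hle, hσ⟩ : ∃ δ' > 0, δ' ≤ δ ∧ (t < tsSigma T t → δ' ≤ tsSigma T t - t) := by
    by_cases hc : t < tsSigma T t
    · exact ⟨min δ (tsSigma T t - t), lt_min hδ (by linarith), min_le_left _ _,
        fun _ => min_le_right _ _⟩
    · exact ⟨δ, hδ, le_rfl, fun h => absurd h hc⟩
  refine ⟨δ', hδ', fun h ε hint hh s hs hst => ?_⟩
  have e : (∫ u in s..tsSigma T t, h (tsP T u)) - (tsSigma T t - s) • h t
      = ∫ u in s..tsSigma T t, (h (tsP T u) - h t) := by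
    rw [intervalIntegral.integral_sub (hint _ _) intervalIntegrable_const]
    simp
  rw [e]
  apply intervalIntegral.norm_integral_le_of_norm_le_const_ae
  have hae : ∀ᵐ u : ℝ, u ≠ tsSigma T t := by
    simp [ae_iff]
  filter_upwards [hae] with u hu hmem
  apply hh _ (tsP_mem hT u)
  rw [abs_lt] at hst ⊢
  rw [uIoc, mem_Ioc] at hmem
  rcases le_total s (tsSigma T t) with hc | hc
  · rw [min_eq_left hc, max_eq_right hc] at hmem
    have h1 : s ≤ tsP T u := le_tsP hs hmem.1.le
    have h2 : tsP T u ≤ t := by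
      by_contra hcon
      push Not at hcon
      have := sigma_le (tsP_mem hT u) hcon
      have h3 := tsP_le hT u
      exact hu (le_antisymm hmem.2 (this.trans h3))
    constructor <;> linarith
  · rw [min_eq_right hc, max_eq_left hc] at hmem
    have heq : tsSigma T t = t := by
      by_contra hcon
      have := lt_of_le_of_ne (sigma_ge hT t) (Ne.symm hcon)
      linarith [hσ this]
    rw [heq] at hmem
    have h3 := tsP_le hT u
    have h4 : t ≤ tsP T u := le_tsP (heq ▸ sigma_mem hT t) hmem.1.le
    constructor <;> linarith

/-- Picard iteration for the forward initial value problem. -/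
lemma ivp {n : ℕ} {T : Set ℝ} (hT : APTimeScale T)
    (N : (ℝ → Fin n → ℝ) → ℝ → Fin n → ℝ) (L A : ℝ) (hL : 0 ≤ L) (hA : 0 ≤ A)
    (hNc : ∀ x, Continuous x → ContinuousOn (N x) T)
    (hNL : ∀ x y, ∀ t ∈ T, ∀ D, (∀ s ∈ T, s ≤ t → ‖x s - y s‖ ≤ D) →
      ‖N x t - N y t‖ ≤ L * D)
    (hN0 : ∀ t ∈ T, ‖N (fun _ => 0) t‖ ≤ A) (t0 : ℝ) :
    ∃ x : ℝ → Fin n → ℝ, Continuous x ∧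
      (∀ a b, IntervalIntegrable (fun u => N x (tsP T u)) volume a b) ∧
      ∀ t, x t = ∫ u in t0..(max t t0), N x (tsP T u) := by
  set lam := 2 * L + 1 with hlam
  have hlam0 : 0 < lam := by positivity
  set w : ℝ → ℝ := fun t => Real.exp (lam * max (t - t0) 0) with hw
  have hwc : Continuous w := by fun_prop
  have hwpos : ∀ t, 0 < w t := fun t => Real.exp_pos _
  have hw1 : ∀ t, 1 ≤ w t := fun t => Real.one_le_exp (by positivity)
  have hwm : Monotone w := fun s t hst => by
    apply Real.exp_le_exp.mpr
    apply mul_le_mul_of_nonneg_left _ hlam0.le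
    exact max_le_max (by linarith) le_rfl
  -- integral estimate
  have hI : ∀ (k : ℝ → Fin n → ℝ) (C : ℝ), (∀ u, ‖k u‖ ≤ C * w u) → ∀ t,
      ‖∫ u in t0..(max t t0), k u‖ ≤ C / lam * w t := by
    intro k C hk t
    have hC : 0 ≤ C := by
      have := (norm_nonneg _).trans (hk t0)
      exact nonneg_of_mul_nonneg_left this (hwpos t0)
    have hder : ∀ u, HasDerivAt (fun u => C / lam * Real.exp (lam * (u - t0)))
        (C * Real.exp (lam * (u - t0))) u := by
      intro u
      have h1 : HasDerivAt (fun r => lam * (r - t0)) lam u := by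
        simpa using ((hasDerivAt_id u).sub_const t0).const_mul lam
      have h2 := (h1.exp).const_mul (C / lam)
      rwa [mul_comm (Real.exp _) lam, ← mul_assoc, div_mul_cancel₀ _ hlam0.ne'] at h2
    have hcont : Continuous (fun u => C * Real.exp (lam * (u - t0))) := by fun_prop
    have hb := intervalIntegral.norm_integral_le_of_norm_le (f := k)
      (g := fun u => C * Real.exp (lam * (u - t0))) (μ := volume) (le_max_right t t0)
      (Filter.Eventually.of_forall fun u hu => by
        refine (hk u).trans (le_of_eq ?_)
        simp only [hw]
        rw [max_eq_left (by linarith [hu.1])])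
      (hcont.intervalIntegrable _ _)
    rw [intervalIntegral.integral_eq_sub_of_hasDerivAt (fun u _ => hder u)
      (hcont.intervalIntegrable _ _)] at hb
    refine hb.trans ?_
    have e : Real.exp (lam * (max t t0 - t0)) = w t := by
      simp only [hw]
      congr 2
      rcases le_total t t0 with h | h
      · rw [max_eq_right h, max_eq_right (by linarith)]; ring
      · rw [max_eq_left h, max_eq_left (by linarith)]
    rw [e]
    have : 0 ≤ C / lam * Real.exp (lam * (t0 - t0)) := by positivity
    linarith
  -- pointwise bounds for N
  have hXb : ∀ y : BoundedContinuousFunction ℝ (Fin n → ℝ), ∀ s, ‖w s • y s‖ ≤ ‖y‖ * w s := by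
    intro y s
    rw [norm_smul, Real.norm_eq_abs, abs_of_pos (hwpos s), mul_comm]
    exact mul_le_mul_of_nonneg_right (y.norm_coe_le_norm s) (hwpos s).le
  set X : BoundedContinuousFunction ℝ (Fin n → ℝ) → ℝ → Fin n → ℝ :=
    fun y s => w s • y s with hX
  have hXc : ∀ y, Continuous (X y) := fun y => hwc.smul y.continuous
  have hNd : ∀ y z, ∀ u, ‖N (X y) (tsP T u) - N (X z) (tsP T u)‖ ≤ L * dist y z * w u := by
    intro y z u
    rw [mul_assoc]
    apply hNL _ _ _ (tsP_mem hT u)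
    intro s hs hsu
    have h1 : X y s - X z s = w s • (y - z) s := by
      simp [hX, smul_sub]
    rw [h1, dist_eq_norm]
    refine (hXb (y - z) s).trans ?_
    exact mul_le_mul_of_nonneg_left (hwm (hsu.trans (tsP_le hT u))) (norm_nonneg _)
  have hX0 : X 0 = fun _ => 0 := by funext s; simp [hX]
  have hNb : ∀ y, ∀ u, ‖N (X y) (tsP T u)‖ ≤ (L * dist y 0 + A) * w u := by
    intro y u
    have h1 := hNd y 0 u
    have h2 := hN0 _ (tsP_mem hT u)
    rw [hX0] at h1
    have h3 := norm_le_norm_sub_add (N (X y) (tsP T u)) (N (fun _ => 0) (tsP T u))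
    have h4 : A ≤ A * w u := le_mul_of_one_le_right hA (hw1 u)
    rw [add_mul]
    linarith
  have hint : ∀ y, ∀ a b, IntervalIntegrable (fun u => N (X y) (tsP T u)) volume a b := by
    intro y a b
    have hc : Continuous (fun u => (L * dist y 0 + A) * w u) := by fun_prop
    refine (hc.intervalIntegrable a b).mono_fun'
      (tsP_meas hT (hNc _ (hXc y))).aestronglyMeasurable ?_
    exact Filter.Eventually.of_forall fun u => hNb y u
  have hprim : ∀ y, Continuous (fun t => ∫ u in t0..(max t t0), N (X y) (tsP T u)) := by
    intro y
    exact (intervalIntegral.continuous_primitive (hint y) t0).comp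
      (continuous_id.max continuous_const)
  let Φ : BoundedContinuousFunction ℝ (Fin n → ℝ) → BoundedContinuousFunction ℝ (Fin n → ℝ) :=
    fun y => BoundedContinuousFunction.ofNormedAddCommGroup
      (fun t => (w t)⁻¹ • ∫ u in t0..(max t t0), N (X y) (tsP T u))
      ((hwc.inv₀ fun t => (hwpos t).ne').smul (hprim y))
      ((L * dist y 0 + A) / lam) (fun t => by
        rw [norm_smul, norm_inv, Real.norm_eq_abs, abs_of_pos (hwpos t), inv_mul_le_iff₀ (hwpos t),
          mul_comm]
        exact hI _ _ (hNb y) t)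
  have hΦ : ∀ y t, Φ y t = (w t)⁻¹ • ∫ u in t0..(max t t0), N (X y) (tsP T u) := fun _ _ => rfl
  have hcontr : ContractingWith (1 / 2 : NNReal) Φ := by
    refine ⟨by norm_num, LipschitzWith.of_dist_le_mul fun y z => ?_⟩
    rw [BoundedContinuousFunction.dist_le (by positivity)]
    intro t
    rw [dist_eq_norm, hΦ, hΦ, ← smul_sub,
      ← intervalIntegral.integral_sub (hint y _ _) (hint z _ _),
      norm_smul, norm_inv, Real.norm_eq_abs, abs_of_pos (hwpos t), inv_mul_le_iff₀ (hwpos t)]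
    refine (hI _ _ (hNd y z) t).trans ?_
    rw [mul_comm]
    apply mul_le_mul_of_nonneg_left _ (hwpos t).le
    rw [div_le_iff₀ hlam0, hlam]
    push_cast
    nlinarith [dist_nonneg (x := y) (y := z)]
  set y := ContractingWith.fixedPoint Φ hcontr with hy
  have hfix : Φ y = y := hcontr.fixedPoint_isFixedPt
  refine ⟨X y, hXc y, hint y, fun t => ?_⟩
  have h1 := hΦ y t
  rw [hfix] at h1
  simp only [hX] at h1 ⊢
  rw [h1, smul_smul, mul_inv_cancel₀ (hwpos t).ne', one_smul]

/-! ### The network -/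

/-- Nonlinear part of the network. -/
noncomputable def cnnG {n : ℕ} (a b : Fin n → Fin n → ℝ → ℝ)
    (f : Fin n → ℝ → ℝ) (γ : Fin n → Fin n → ℝ) (I : Fin n → ℝ → ℝ)
    (x : ℝ → Fin n → ℝ) (t : ℝ) (i : Fin n) : ℝ :=
  (∑ j, a i j t * f j (x t j)) + (∑ j, b i j t * f j (x (t - γ i j) j)) + I i t

/-- Right-hand side of the network. -/
noncomputable def cnnN {n : ℕ} (c : Fin n → ℝ → ℝ) (a b : Fin n → Fin n → ℝ → ℝ)
    (f : Fin n → ℝ → ℝ) (γ : Fin n → Fin n → ℝ) (I : Fin n → ℝ → ℝ)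
    (x : ℝ → Fin n → ℝ) (t : ℝ) (i : Fin n) : ℝ :=
  -(c i t) * x t i + cnnG a b f γ I x t i

/-- Working hypotheses, with explicit constants. -/
structure CNNHyp {n : ℕ} (T : Set ℝ) (c : Fin n → ℝ → ℝ) (a b : Fin n → Fin n → ℝ → ℝ)
    (f : Fin n → ℝ → ℝ) (γ : Fin n → Fin n → ℝ) (I : Fin n → ℝ → ℝ)
    (α : Fin n → ℝ) (r0 : ℝ) (cl : Fin n → ℝ) (C : ℝ) (Ab Bb : Fin n → Fin n → ℝ)
    (Ib : Fin n → ℝ) (q c0 : ℝ) : Prop where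
  hT : APTimeScale T
  hr0 : 0 < r0
  hfc : ∀ j, Continuous (f j)
  hα : ∀ j, 0 < α j
  hlip : ∀ j, ∀ x y : ℝ, |f j x - f j y| ≤ α j * |x - y|
  cc : ∀ i, ContinuousOn (c i) T
  ac : ∀ i j, ContinuousOn (a i j) T
  bc : ∀ i j, ContinuousOn (b i j) T
  Ic : ∀ i, ContinuousOn (I i) T
  hreg : ∀ i, ∀ t ∈ T, 0 < 1 - tsGrain T t * c i t
  hγ : ∀ i j, γ i j ∈ tsPi T ∧ 0 ≤ γ i j
  hc : ∀ i, ∀ t ∈ T, cl i ≤ c i t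
  hC0 : 0 ≤ C
  hC : ∀ i, ∀ t ∈ T, c i t ≤ C
  ha : ∀ i j, ∀ t ∈ T, |a i j t| ≤ Ab i j
  hb : ∀ i j, ∀ t ∈ T, |b i j t| ≤ Bb i j
  hI : ∀ i, ∀ t ∈ T, |I i t| ≤ Ib i
  hq0 : 0 ≤ q
  hqc : q < c0
  hcl : ∀ i, c0 ≤ cl i
  hq : ∀ i, ∑ j, (Ab i j + Bb i j) * α j ≤ q
  hr : ∀ i, (∑ j, (Ab i j + Bb i j) * (|f j 0| + α j * r0)) + Ib i ≤ r0 * cl i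

lemma sum_est {n : ℕ} (f : Fin n → ℝ → ℝ) (α : Fin n → ℝ) (hα : ∀ j, 0 < α j)
    (hlip : ∀ j, ∀ x y : ℝ, |f j x - f j y| ≤ α j * |x - y|)
    (a a' A X X' : Fin n → ℝ) (M E : ℝ) (hA : ∀ j, |a j| ≤ A j)
    (hX : ∀ j, |X' j - X j| ≤ M)
    (hE : ∀ j, |a' j - a j| * |f j (X' j)| ≤ E) :
    |(∑ j, a' j * f j (X' j)) - ∑ j, a j * f j (X j)| ≤ (∑ j, A j * α j) * M + n * E := by
  rw [← Finset.sum_sub_distrib, Finset.sum_mul]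
  have h2 : (n : ℝ) * E = ∑ _j : Fin n, E := by simp
  rw [h2, ← Finset.sum_add_distrib]
  refine (Finset.abs_sum_le_sum_abs _ _).trans (Finset.sum_le_sum fun j _ => ?_)
  have e : a' j * f j (X' j) - a j * f j (X j)
      = a j * (f j (X' j) - f j (X j)) + (a' j - a j) * f j (X' j) := by ring
  rw [e]
  refine (abs_add_le _ _).trans ?_
  rw [abs_mul, abs_mul]
  have h3 : |a j| * |f j (X' j) - f j (X j)| ≤ A j * (α j * M) := by
    apply mul_le_mul (hA j) _ (abs_nonneg _) ((abs_nonneg _).trans (hA j))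
    exact (hlip j _ _).trans (mul_le_mul_of_nonneg_left (hX j) (hα j).le)
  have := hE j
  linarith

lemma sum_bd {n : ℕ} (f : Fin n → ℝ → ℝ) (α : Fin n → ℝ) (hα : ∀ j, 0 < α j)
    (hlip : ∀ j, ∀ x y : ℝ, |f j x - f j y| ≤ α j * |x - y|)
    (a A X : Fin n → ℝ) (r : ℝ) (hA : ∀ j, |a j| ≤ A j) (hX : ∀ j, |X j| ≤ r) :
    |∑ j, a j * f j (X j)| ≤ ∑ j, A j * (|f j 0| + α j * r) := by
  refine (Finset.abs_sum_le_sum_abs _ _).trans (Finset.sum_le_sum fun j _ => ?_)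
  rw [abs_mul]
  apply mul_le_mul (hA j) _ (abs_nonneg _) ((abs_nonneg _).trans (hA j))
  have h1 := hlip j (X j) 0
  rw [sub_zero] at h1
  have h2 := mul_le_mul_of_nonneg_left (hX j) (hα j).le
  have h3 := abs_sub_abs_le_abs_sub (f j (X j)) (f j 0)
  linarith

section
variable {n : ℕ} {T : Set ℝ} {c : Fin n → ℝ → ℝ} {a b : Fin n → Fin n → ℝ → ℝ}
    {f : Fin n → ℝ → ℝ} {γ : Fin n → Fin n → ℝ} {I : Fin n → ℝ → ℝ}
    {α : Fin n → ℝ} {r0 : ℝ} {cl : Fin n → ℝ} {C : ℝ} {Ab Bb : Fin n → Fin n → ℝ}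
    {Ib : Fin n → ℝ} {q c0 : ℝ}

/-- Difference estimate of the nonlinear part at possibly different times. -/
lemma CNNHyp.G_est (H : CNNHyp T c a b f γ I α r0 cl C Ab Bb Ib q c0)
    (x y : ℝ → Fin n → ℝ) (t t' M E : ℝ) (ht : t ∈ T) (hM : 0 ≤ M) (i : Fin n)
    (h1 : ‖x t' - y t‖ ≤ M) (h2 : ∀ j, ‖x (t' - γ i j) - y (t - γ i j)‖ ≤ M)
    (h3 : ∀ j, |a i j t' - a i j t| * |f j (x t' j)| ≤ E)
    (h4 : ∀ j, |b i j t' - b i j t| * |f j (x (t' - γ i j) j)| ≤ E)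
    (h5 : |I i t' - I i t| ≤ E) :
    |cnnG a b f γ I x t' i - cnnG a b f γ I y t i| ≤ q * M + (2 * n + 1) * E := by
  have k1 := sum_est f α H.hα H.hlip (fun j => a i j t) (fun j => a i j t') (Ab i)
    (fun j => y t j) (fun j => x t' j) M E (fun j => H.ha i j t ht)
    (fun j => (norm_le_pi_norm (x t' - y t) j).trans h1) h3
  have k2 := sum_est f α H.hα H.hlip (fun j => b i j t) (fun j => b i j t') (Bb i)
    (fun j => y (t - γ i j) j) (fun j => x (t' - γ i j) j) M E (fun j => H.hb i j t ht)
    (fun j => (norm_le_pi_norm (x (t' - γ i j) - y (t - γ i j)) j).trans (h2 j)) h4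
  have k3 := mul_le_mul_of_nonneg_right (H.hq i) hM
  have k4 : ∑ j, (Ab i j + Bb i j) * α j = (∑ j, Ab i j * α j) + ∑ j, Bb i j * α j := by
    rw [← Finset.sum_add_distrib]
    exact Finset.sum_congr rfl fun j _ => by ring
  rw [k4] at k3
  unfold cnnG
  rw [abs_le] at *
  constructor <;> linarith [k1.1, k1.2, k2.1, k2.2, h5.1, h5.2]

lemma CNNHyp.G_bd (H : CNNHyp T c a b f γ I α r0 cl C Ab Bb Ib q c0)
    (x : ℝ → Fin n → ℝ) (t r : ℝ) (ht : t ∈ T) (hr : r0 ≤ r) (i : Fin n)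
    (h1 : ‖x t‖ ≤ r) (h2 : ∀ j, ‖x (t - γ i j)‖ ≤ r) :
    |cnnG a b f γ I x t i| ≤ r0 * cl i + q * (r - r0) := by
  have k1 := sum_bd f α H.hα H.hlip (fun j => a i j t) (Ab i)
    (fun j => x t j) r (fun j => H.ha i j t ht)
    (fun j => (norm_le_pi_norm (x t) j).trans h1)
  have k2 := sum_bd f α H.hα H.hlip (fun j => b i j t) (Bb i)
    (fun j => x (t - γ i j) j) r (fun j => H.hb i j t ht)
    (fun j => (norm_le_pi_norm (x (t - γ i j)) j).trans (h2 j))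
  have k3 := mul_le_mul_of_nonneg_right (H.hq i) (sub_nonneg.mpr hr)
  have k4 : (∑ j, Ab i j * (|f j 0| + α j * r)) + ∑ j, Bb i j * (|f j 0| + α j * r)
      = (∑ j, (Ab i j + Bb i j) * (|f j 0| + α j * r0))
        + (∑ j, (Ab i j + Bb i j) * α j) * (r - r0) := by
    rw [← Finset.sum_add_distrib, Finset.sum_mul, ← Finset.sum_add_distrib]
    exact Finset.sum_congr rfl fun j _ => by ring
  have k5 := H.hr i
  have k6 := H.hI i t ht
  unfold cnnG
  refine (abs_add_three _ _ _).trans ?_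
  linarith

lemma CNNHyp.cpos (H : CNNHyp T c a b f γ I α r0 cl C Ab Bb Ib q c0) (i : Fin n) {t : ℝ}
    (ht : t ∈ T) : 0 < c i t ∧ cl i ≤ C ∧ 0 < cl i := by
  have h1 := H.hc i t ht
  have h2 := H.hcl i
  have h3 := H.hq0
  have h4 := H.hqc
  have h5 := H.hC i t ht
  refine ⟨?_, ?_, ?_⟩ <;> linarith

lemma CNNHyp.N_bd (H : CNNHyp T c a b f γ I α r0 cl C Ab Bb Ib q c0)
    (x : ℝ → Fin n → ℝ) (hx : ∀ t ∈ T, ‖x t‖ ≤ r0) (t : ℝ) (ht : t ∈ T) :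
    ‖cnnN c a b f γ I x t‖ ≤ 2 * C * r0 := by
  have hC := H.hC0
  have hr0 := H.hr0
  rw [pi_norm_le_iff_of_nonneg (by positivity)]
  intro i
  have k1 := H.G_bd x t r0 ht le_rfl i (hx t ht) (fun j => hx _ ((H.hγ i j).1 t ht).2)
  obtain ⟨h1, h2, h3⟩ := H.cpos i ht
  have h4 := H.hC i t ht
  have k2 : |x t i| ≤ r0 := (norm_le_pi_norm (x t) i).trans (hx t ht)
  unfold cnnN
  rw [Real.norm_eq_abs]
  refine (abs_add_le _ _).trans ?_
  rw [abs_mul, abs_neg, abs_of_pos h1]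
  have k3 : c i t * |x t i| ≤ C * r0 := mul_le_mul h4 k2 (abs_nonneg _) hC
  have k4 : r0 * cl i ≤ r0 * C := mul_le_mul_of_nonneg_left h2 hr0.le
  linarith

lemma CNNHyp.N_lip (H : CNNHyp T c a b f γ I α r0 cl C Ab Bb Ib q c0)
    (x y : ℝ → Fin n → ℝ) (t : ℝ) (ht : t ∈ T) (D : ℝ)
    (hD : ∀ s ∈ T, s ≤ t → ‖x s - y s‖ ≤ D) :
    ‖cnnN c a b f γ I x t - cnnN c a b f γ I y t‖ ≤ (C + q) * D := by
  have hD0 : 0 ≤ D := (norm_nonneg _).trans (hD t ht le_rfl)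
  have hC := H.hC0
  have hq := H.hq0
  rw [pi_norm_le_iff_of_nonneg (by positivity)]
  intro i
  have k1 := H.G_est x y t t D 0 ht hD0 i (hD t ht le_rfl)
    (fun j => hD _ ((H.hγ i j).1 t ht).2 (by linarith [(H.hγ i j).2]))
    (by simp) (by simp) (by simp)
  obtain ⟨h1, h2, h3⟩ := H.cpos i ht
  have h4 := H.hC i t ht
  have k2 : |x t i - y t i| ≤ D := (norm_le_pi_norm (x t - y t) i).trans (hD t ht le_rfl)
  rw [Pi.sub_apply, Real.norm_eq_abs]
  unfold cnnN
  have e : -c i t * x t i + cnnG a b f γ I x t i - (-c i t * y t i + cnnG a b f γ I y t i)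
    = -c i t * (x t i - y t i) + (cnnG a b f γ I x t i - cnnG a b f γ I y t i) := by ring
  rw [e]
  refine (abs_add_le _ _).trans ?_
  rw [abs_mul, abs_neg, abs_of_pos h1]
  have k3 : c i t * |x t i - y t i| ≤ C * D := mul_le_mul h4 k2 (abs_nonneg _) hC
  linarith

lemma CNNHyp.N_cont (H : CNNHyp T c a b f γ I α r0 cl C Ab Bb Ib q c0)
    (x : ℝ → Fin n → ℝ) (hx : Continuous x) : ContinuousOn (cnnN c a b f γ I x) T := by
  rw [continuousOn_pi]
  intro i
  unfold cnnN cnnG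
  have hxi : ∀ j, Continuous (fun t => x t j) := fun j => (continuous_apply j).comp hx
  refine ((H.cc i).neg.mul (hxi i).continuousOn).add ((ContinuousOn.add ?_ ?_).add (H.Ic i))
  · refine continuousOn_finsetSum _ fun j _ => (H.ac i j).mul ?_
    exact ((H.hfc j).comp (hxi j)).continuousOn
  · refine continuousOn_finsetSum _ fun j _ => (H.bc i j).mul ?_
    exact ((H.hfc j).comp ((hxi j).comp (continuous_id.sub continuous_const))).continuousOn

/-- Equicontinuity of the right-hand side. -/
lemma CNNHyp.N_equi (H : CNNHyp T c a b f γ I α r0 cl C Ab Bb Ib q c0) (Lam : ℝ)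
    (hLam : 0 ≤ Lam) (t : ℝ) (ht : t ∈ T) (ε : ℝ) (hε : 0 < ε) :
    ∃ δ > 0, ∀ x : ℝ → Fin n → ℝ, (∀ s ∈ T, ‖x s‖ ≤ r0) →
      (∀ s ∈ T, ∀ s' ∈ T, ‖x s - x s'‖ ≤ Lam * |s - s'|) →
      ∀ r ∈ T, |r - t| < δ → ‖cnnN c a b f γ I x r - cnnN c a b f γ I x t‖ ≤ ε := by
  have hr0 := H.hr0
  have hC := H.hC0
  have hq := H.hq0
  set F : ℝ := 1 + ∑ j, (|f j 0| + α j * r0) with hF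
  have hterm : ∀ j, 0 ≤ |f j 0| + α j * r0 := fun j => by
    have := H.hα j
    positivity
  have hF1 : 1 ≤ F := by
    have : 0 ≤ ∑ j, (|f j 0| + α j * r0) := Finset.sum_nonneg fun j _ => hterm j
    linarith
  have hFb : ∀ j z, |z| ≤ r0 → |f j z| ≤ F := by
    intro j z hz
    have h1 := H.hlip j z 0
    rw [sub_zero] at h1
    have h2 := mul_le_mul_of_nonneg_left hz (H.hα j).le
    have h3 := abs_sub_abs_le_abs_sub (f j z) (f j 0)
    have h4 := Finset.single_le_sum (f := fun j => |f j 0| + α j * r0)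
      (fun j _ => hterm j) (Finset.mem_univ j)
    linarith
  -- small parameter
  set e : ℝ := ε / (2 * (r0 + (2 * n + 1) * F)) with he
  have hden : 0 < 2 * (r0 + (2 * n + 1) * F) := by positivity
  have he0 : 0 < e := by positivity
  have heF : e * (r0 + (2 * n + 1) * F) = ε / 2 := by
    rw [he]; field_simp
  have hev : ∀ g : ℝ → ℝ, ContinuousOn g T → ∀ᶠ r in nhdsWithin t T, |g r - g t| < e := by
    intro g hg
    have := Metric.tendsto_nhds.mp (hg t ht) e he0
    simpa [Real.dist_eq] using this
  have h1 : ∀ᶠ r in nhdsWithin t T, ∀ i, |c i r - c i t| < e :=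
    eventually_all.mpr fun i => hev _ (H.cc i)
  have h2 : ∀ᶠ r in nhdsWithin t T, ∀ i j, |a i j r - a i j t| < e :=
    eventually_all.mpr fun i => eventually_all.mpr fun j => hev _ (H.ac i j)
  have h3 : ∀ᶠ r in nhdsWithin t T, ∀ i j, |b i j r - b i j t| < e :=
    eventually_all.mpr fun i => eventually_all.mpr fun j => hev _ (H.bc i j)
  have h4 : ∀ᶠ r in nhdsWithin t T, ∀ i, |I i r - I i t| < e :=
    eventually_all.mpr fun i => hev _ (H.Ic i)
  have h5 := h1.and (h2.and (h3.and h4))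
  rw [eventually_nhdsWithin_iff, Metric.eventually_nhds_iff] at h5
  obtain ⟨δ1, hδ1, h5⟩ := h5
  set δ2 : ℝ := ε / (2 * ((C + q) * Lam + 1)) with hδ2
  have hδ2pos : 0 < δ2 := by positivity
  have hδ2e : (C + q) * (Lam * δ2) ≤ ε / 2 := by
    have : δ2 * ((C + q) * Lam + 1) = ε / 2 := by rw [hδ2]; field_simp
    nlinarith
  refine ⟨min δ1 δ2, lt_min hδ1 hδ2pos, fun x hx hxL r hr hrt => ?_⟩
  obtain ⟨g1, g2, g3, g4⟩ := h5 (show dist r t < δ1 from hrt.trans_le (min_le_left _ _)) hr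
  have hM : ∀ s ∈ T, ∀ s' ∈ T, s - s' = r - t → ‖x s - x s'‖ ≤ Lam * δ2 := by
    intro s hs s' hs' hss
    refine (hxL s hs s' hs').trans (mul_le_mul_of_nonneg_left ?_ hLam)
    rw [hss]
    exact (hrt.trans_le (min_le_right _ _)).le
  rw [pi_norm_le_iff_of_nonneg hε.le]
  intro i
  have hab : ∀ s ∈ T, ∀ j, |f j (x s j)| ≤ F := fun s hs j =>
    hFb j _ ((norm_le_pi_norm (x s) j).trans (hx s hs))
  have k1 := H.G_est x x t r (Lam * δ2) (e * F) ht (by positivity) i (hM r hr t ht rfl)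
    (fun j => hM _ ((H.hγ i j).1 r hr).2 _ ((H.hγ i j).1 t ht).2 (by ring))
    (fun j => mul_le_mul (g2 i j).le (hab r hr j) (abs_nonneg _) he0.le)
    (fun j => mul_le_mul (g3 i j).le (hab _ ((H.hγ i j).1 r hr).2 j) (abs_nonneg _) he0.le)
    ((g4 i).le.trans (le_mul_of_one_le_right he0.le hF1))
  rw [Pi.sub_apply, Real.norm_eq_abs]
  unfold cnnN
  have e1 : -c i r * x r i + cnnG a b f γ I x r i - (-c i t * x t i + cnnG a b f γ I x t i)
    = -c i t * (x r i - x t i) + -(c i r - c i t) * x r i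
      + (cnnG a b f γ I x r i - cnnG a b f γ I x t i) := by ring
  rw [e1]
  refine (abs_add_three _ _ _).trans ?_
  rw [abs_mul, abs_mul, abs_neg, abs_neg, abs_of_pos (H.cpos i ht).1]
  have k2 : c i t * |x r i - x t i| ≤ C * (Lam * δ2) :=
    mul_le_mul (H.hC i t ht) ((norm_le_pi_norm (x r - x t) i).trans (hM r hr t ht rfl))
      (abs_nonneg _) hC
  have k3 : |c i r - c i t| * |x r i| ≤ e * r0 :=
    mul_le_mul (g1 i).le ((norm_le_pi_norm (x r) i).trans (hx r hr)) (abs_nonneg _) he0.le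
  nlinarith

/-- Forward solutions of the network, with a priori bounds. -/
lemma CNNHyp.forward (H : CNNHyp T c a b f γ I α r0 cl C Ab Bb Ib q c0) (t0 : ℝ) (ht0 : t0 ∈ T) :
    ∃ x : ℝ → Fin n → ℝ,
      (∀ a' b', IntervalIntegrable (fun u => cnnN c a b f γ I x (tsP T u)) volume a' b') ∧
      (∀ s t, t0 ≤ s → t0 ≤ t → x t - x s = ∫ u in s..t, cnnN c a b f γ I x (tsP T u)) ∧
      (∀ t ∈ T, ‖x t‖ ≤ r0) ∧
      (∀ s ∈ T, ∀ s' ∈ T, ‖x s - x s'‖ ≤ 2 * C * r0 * |s - s'|) := by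
  have hT := H.hT
  have hr0 := H.hr0
  have hC := H.hC0
  have hq := H.hq0
  obtain ⟨x, hxc, hint, hx⟩ := ivp hT (cnnN c a b f γ I) (C + q) (2 * C * r0) (by positivity)
    (by positivity) (fun x hx => H.N_cont x hx)
    (fun x y t ht D hD => H.N_lip x y t ht D hD)
    (fun t ht => H.N_bd _ (fun s _ => by simpa using hr0.le) t ht) t0
  have hx0 : ∀ t, t ≤ t0 → x t = 0 := by
    intro t ht
    rw [hx t, max_eq_right ht, intervalIntegral.integral_same]
  set z : ℝ → Fin n → ℝ := fun t => ∫ u in t0..t, cnnN c a b f γ I x (tsP T u) with hz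
  have hzx : ∀ t, t0 ≤ t → x t = z t := fun t ht => by rw [hx t, max_eq_left ht]
  have hzsub : ∀ s t, z t - z s = ∫ u in s..t, cnnN c a b f γ I x (tsP T u) := fun s t =>
    intervalIntegral.integral_interval_sub_left (hint _ _) (hint _ _)
  have hzc : Continuous z := intervalIntegral.continuous_primitive hint t0
  have hzi : ∀ j, Continuous (fun t => z t j) := fun j => (continuous_apply j).comp hzc
  -- the primitive is Δ-differentiable
  have hzd : ∀ t ∈ T, ∀ i, deltaDeriv T (fun s => z s i) t (cnnN c a b f γ I x t i) := by
    intro t ht i ε hε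
    have hN := H.N_cont x hxc t ht
    have h1 := Metric.tendsto_nhds.mp hN ε hε
    rw [eventually_nhdsWithin_iff, Metric.eventually_nhds_iff] at h1
    obtain ⟨δ, hδ, h1⟩ := h1
    obtain ⟨δ', hδ', h2⟩ := int_est (n := n) hT (t := t) hδ
    refine ⟨δ', hδ', fun s hs hst => ?_⟩
    have h3 := h2 (cnnN c a b f γ I x) ε hint (fun r hr hrt => by
      have := h1 (show dist r t < δ from hrt) hr
      rw [dist_eq_norm] at this
      exact this.le) s hs hst
    rw [← hzsub] at h3
    exact (norm_le_pi_norm (z (tsSigma T t) - z s - (tsSigma T t - s) • cnnN c a b f γ I x t)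
      i).trans h3
  -- forward invariance of slightly larger balls
  have hinv : ∀ r, r0 < r → ∀ t ∈ T, ‖x t‖ ≤ r := by
    intro r hr
    have hrpos : 0 < r := hr0.trans hr
    have past : ∀ t, (∀ j : Fin n ⊕ Fin n, ∀ s ∈ T, t0 ≤ s → s ≤ t →
        Sum.elim (fun i t => z t i) (fun i t => - z t i) j s ≤ r) →
        ∀ s ∈ T, s ≤ t → ‖x s‖ ≤ r := by
      intro t h s hs hst
      rcases le_total s t0 with h0 | h0
      · rw [hx0 s h0]; simpa using hrpos.le
      · rw [hzx s h0, pi_norm_le_iff_of_nonneg hrpos.le]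
        intro i
        have e1 := h (Sum.inl i) s hs h0 hst
        have e2 := h (Sum.inr i) s hs h0 hst
        simp only [Sum.elim_inl, Sum.elim_inr] at e1 e2
        rw [Real.norm_eq_abs, abs_le]
        constructor <;> linarith
    have hG : ∀ t ∈ T, (∀ s ∈ T, s ≤ t → ‖x s‖ ≤ r) → ∀ i,
        |cnnG a b f γ I x t i| < r * cl i := by
      intro t ht h i
      have k := H.G_bd x t r ht hr.le i (h t ht le_rfl)
        (fun j => h _ ((H.hγ i j).1 t ht).2 (by linarith [(H.hγ i j).2]))
      have h1 := H.hqc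
      have h2 := H.hcl i
      nlinarith
    have hcmp := ts_compare (ι := Fin n ⊕ Fin n) hT ht0
      (Sum.elim (fun i t => z t i) (fun i t => - z t i))
      (Sum.elim (fun i t => cnnN c a b f γ I x t i) (fun i t => - cnnN c a b f γ I x t i))
      (fun _ => r) (fun _ => 0) (fun t => hasDerivAt_const t r)
      (by
        rintro (i | i)
        · exact (hzi i).continuousOn
        · exact (hzi i).neg.continuousOn)
      (by
        rintro (i | i) t ht _
        · exact hzd t ht i
        · exact deltaDeriv_neg (hzd t ht i))
      (by
        have h0 : z t0 = 0 := by simp [hz]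
        rintro (i | i) <;> simp [h0, hrpos.le])
      (by
        intro k t ht htt hall heq
        have hp := past t hall
        have hxz := hzx t htt
        rcases k with i | i
        · simp only [Sum.elim_inl] at heq ⊢
          have h1 := abs_lt.mp (hG t ht hp i)
          have h2 := H.hc i t ht
          unfold cnnN
          rw [hxz, heq]
          nlinarith [h1.2]
        · simp only [Sum.elim_inr] at heq ⊢
          have h1 := abs_lt.mp (hG t ht hp i)
          have h2 := H.hc i t ht
          unfold cnnN
          rw [hxz, show z t i = -r by linarith]
          nlinarith [h1.1])
      (by
        intro k t ht htt hall
        have hp := past t hall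
        have hxz := hzx t htt
        have hk := hall k t ht htt le_rfl
        have hmu : 0 ≤ tsGrain T t := by unfold tsGrain; linarith [sigma_ge hT t]
        rcases k with i | i
        · simp only [Sum.elim_inl] at hk ⊢
          have h1 := abs_lt.mp (hG t ht hp i)
          have h2 := H.hc i t ht
          have h3 := H.hreg i t ht
          unfold cnnN
          rw [hxz]
          have h4 := mul_le_mul_of_nonneg_left hk h3.le
          have h5 := mul_le_mul_of_nonneg_left h1.2.le hmu
          have h6 := mul_le_mul_of_nonneg_left (mul_le_mul_of_nonneg_left h2 hrpos.le) hmu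
          nlinarith
        · simp only [Sum.elim_inr] at hk ⊢
          have h1 := abs_lt.mp (hG t ht hp i)
          have h2 := H.hc i t ht
          have h3 := H.hreg i t ht
          unfold cnnN
          rw [hxz]
          have h4 := mul_le_mul_of_nonneg_left hk h3.le
          have h5 := mul_le_mul_of_nonneg_left h1.1.le hmu
          have h6 := mul_le_mul_of_nonneg_left (mul_le_mul_of_nonneg_left h2 hrpos.le) hmu
          nlinarith)
    intro t ht
    exact past t (fun j s hs h0 _ => hcmp j s hs h0) t ht le_rfl
  have hb : ∀ t ∈ T, ‖x t‖ ≤ r0 := fun t ht => le_of_forall_gt_imp_ge_of_dense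
    fun r hr => hinv r hr t ht
  refine ⟨x, hint, fun s t hs ht => ?_, hb, fun s _ s' _ => ?_⟩
  · rw [hzx s hs, hzx t ht, hzsub]
  · have e : x s - x s' = ∫ u in (max s' t0)..(max s t0), cnnN c a b f γ I x (tsP T u) := by
      rw [hx s, hx s']
      exact hzsub _ _
    rw [e]
    have h1 := intervalIntegral.norm_integral_le_of_norm_le_const (a := max s' t0)
      (b := max s t0) (C := 2 * C * r0)
      (f := fun u => cnnN c a b f γ I x (tsP T u))
      (fun u _ => H.N_bd x hb _ (tsP_mem hT u))
    refine h1.trans (mul_le_mul_of_nonneg_left ?_ (by positivity))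
    exact abs_max_sub_max_le_abs s s' t0

/-- Existence of a bounded entire solution, by compactness. -/
lemma CNNHyp.entire (H : CNNHyp T c a b f γ I α r0 cl C Ab Bb Ib q c0) :
    ∃ x : ℝ → Fin n → ℝ, ContinuousOn x T ∧ (∀ t ∈ T, ‖x t‖ ≤ r0) ∧
      ∀ t ∈ T, ∀ i, deltaDeriv T (fun s => x s i) t (cnnN c a b f γ I x t i) := by
  have hT := H.hT
  have hr0 := H.hr0
  have hC := H.hC0
  choose τ hτT hτ using fun k : ℕ => ts_below hT (-(k : ℝ))
  choose X hint hXi hXb hXL using fun k => H.forward (τ k) (hτT k)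
  let U : Ultrafilter ℕ := Filter.hyperfilter ℕ
  have hU : (U : Filter ℕ) ≤ atTop := Nat.hyperfilter_le_atTop
  have hlim : ∀ t, ∃ l : Fin n → ℝ, t ∈ T → ‖l‖ ≤ r0 ∧ Tendsto (fun k => X k t) U (nhds l) := by
    intro t
    by_cases ht : t ∈ T
    · have hcp : IsCompact (Metric.closedBall (0 : Fin n → ℝ) r0) := isCompact_closedBall _ _
      obtain ⟨l, hl, hl'⟩ := hcp.ultrafilter_le_nhds' (U.map (fun k => X k t))
        (Filter.mem_map.mpr (Filter.univ_mem' fun k => by simpa using hXb k t ht))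
      exact ⟨l, fun _ => ⟨by simpa using hl, hl'⟩⟩
    · exact ⟨0, fun h => absurd h ht⟩
  choose x hx using hlim
  have hxb : ∀ t ∈ T, ‖x t‖ ≤ r0 := fun t ht => (hx t ht).1
  have hxt : ∀ t ∈ T, Tendsto (fun k => X k t) U (nhds (x t)) := fun t ht => (hx t ht).2
  have hxti : ∀ t ∈ T, ∀ i, Tendsto (fun k => X k t i) U (nhds (x t i)) := fun t ht i =>
    (tendsto_pi_nhds.mp (hxt t ht)) i
  have hxL : ∀ s ∈ T, ∀ s' ∈ T, ‖x s - x s'‖ ≤ 2 * C * r0 * |s - s'| := fun s hs s' hs' =>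
    le_of_tendsto ((hxt s hs).sub (hxt s' hs')).norm
      (Filter.Eventually.of_forall fun k => hXL k s hs s' hs')
  refine ⟨x, ?_, hxb, ?_⟩
  · have : LipschitzOnWith (Real.toNNReal (2 * C * r0)) x T := by
      apply LipschitzOnWith.of_dist_le_mul
      intro s hs s' hs'
      rw [dist_eq_norm, Real.dist_eq, Real.coe_toNNReal _ (by positivity)]
      exact hxL s hs s' hs'
    exact this.continuousOn
  · intro t ht i ε hε
    obtain ⟨δ, hδ, h1⟩ := H.N_equi (2 * C * r0) (by positivity) t ht ε hε
    obtain ⟨δ', hδ', h2⟩ := int_est (n := n) hT (t := t) hδ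
    refine ⟨δ', hδ', fun s hs hst => ?_⟩
    have hσ := sigma_mem hT t
    have hNt : Tendsto (fun k => cnnN c a b f γ I (X k) t i) U (nhds (cnnN c a b f γ I x t i)) := by
      unfold cnnN cnnG
      refine ((hxti t ht i).const_mul _).add (Tendsto.add (Tendsto.add ?_ ?_) tendsto_const_nhds)
      · refine tendsto_finsetSum _ fun j _ => Tendsto.const_mul _ ?_
        exact ((H.hfc j).tendsto _).comp (hxti t ht j)
      · refine tendsto_finsetSum _ fun j _ => Tendsto.const_mul _ ?_
        exact ((H.hfc j).tendsto _).comp (hxti _ ((H.hγ i j).1 t ht).2 j)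
    have hT1 : Tendsto (fun k => ‖X k (tsSigma T t) i - X k s i
        - (tsSigma T t - s) • cnnN c a b f γ I (X k) t i‖) U
        (nhds ‖x (tsSigma T t) i - x s i - (tsSigma T t - s) • cnnN c a b f γ I x t i‖) :=
      (((hxti _ hσ i).sub (hxti s hs i)).sub (hNt.const_smul _)).norm
    refine le_of_tendsto hT1 ?_
    obtain ⟨k0, hk0⟩ := exists_nat_gt (δ' - t)
    have hev : ∀ᶠ k in (U : Filter ℕ), k0 ≤ k := hU (eventually_ge_atTop k0)
    filter_upwards [hev] with k hk
    have hkr : (k0 : ℝ) ≤ k := by exact_mod_cast hk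
    have hτs : τ k ≤ s := by
      have := hτ k
      have h3 := (abs_lt.mp hst).1
      linarith
    have hτσ : τ k ≤ tsSigma T t := by
      have := hτ k
      have h3 := sigma_ge hT t
      linarith
    have h4 := h2 (cnnN c a b f γ I (X k)) ε (hint k) (h1 (X k) (hXb k) (hXL k)) s hs hst
    rw [← hXi k s _ hτs hτσ] at h4
    exact (norm_le_pi_norm (X k (tsSigma T t) - X k s
      - (tsSigma T t - s) • cnnN c a b f γ I (X k) t) i).trans h4

/-- Estimate for bounded entire solutions of coupled linear inequalities. -/
lemma CNNHyp.diff (H : CNNHyp T c a b f γ I α r0 cl C Ab Bb Ib q c0)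
    (z g : ℝ → Fin n → ℝ) (R E : ℝ) (hE : 0 ≤ E) (hz : ContinuousOn z T)
    (hR : ∀ t ∈ T, ‖z t‖ ≤ R)
    (hd : ∀ t ∈ T, ∀ i, deltaDeriv T (fun s => z s i) t (-(c i t) * z t i + g t i))
    (hg : ∀ M, 0 ≤ M → (∀ t ∈ T, ‖z t‖ ≤ M) → ∀ t ∈ T, ∀ i, |g t i| ≤ q * M + E) :
    ∀ t ∈ T, ‖z t‖ ≤ E / (c0 - q) := by
  have hT := H.hT
  have hq := H.hq0
  have hqc := H.hqc
  have hc0 : 0 < c0 := by linarith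
  obtain ⟨t1, ht1⟩ := hT.1
  set S := (fun t => ‖z t‖) '' T with hS
  have hSb : BddAbove S := ⟨R, by rintro _ ⟨t, ht, rfl⟩; exact hR t ht⟩
  have hSne : S.Nonempty := ⟨_, t1, ht1, rfl⟩
  have hM : ∀ t ∈ T, ‖z t‖ ≤ sSup S := fun t ht => le_csSup hSb ⟨t, ht, rfl⟩
  have hM0 : 0 ≤ sSup S := (norm_nonneg _).trans (hM t1 ht1)
  have hK : 0 ≤ (q * sSup S + E) / c0 := by positivity
  have key : ∀ t ∈ T, ‖z t‖ ≤ (q * sSup S + E) / c0 := by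
    intro t ht
    rw [pi_norm_le_iff_of_nonneg hK]
    intro i
    refine ts_maxprin hT (fun s => z s i) (c i) (fun s => g s i) c0 _ R hc0
      ((continuousOn_pi.mp hz) i) (fun s hs => (norm_le_pi_norm (z s) i).trans (hR s hs))
      (fun s hs => (H.hcl i).trans (H.hc i s hs)) (H.hreg i) hK (fun s hs => ?_)
      (fun s hs => hd s hs i) t ht
    rw [div_mul_cancel₀ _ hc0.ne']
    exact hg _ hM0 hM s hs i
  have h1 : sSup S ≤ (q * sSup S + E) / c0 := csSup_le hSne (by
    rintro _ ⟨t, ht, rfl⟩; exact key t ht)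
  rw [le_div_iff₀ hc0] at h1
  have h2 : sSup S ≤ E / (c0 - q) := by
    rw [le_div_iff₀ (by linarith)]
    linarith
  exact fun t ht => (hM t ht).trans h2

/-- Bounded entire solutions are almost periodic. -/
lemma CNNHyp.sol_ap (H : CNNHyp T c a b f γ I α r0 cl C Ab Bb Ib q c0)
    (hcap : ∀ i, APfun T (c i)) (haap : ∀ i j, APfun T (a i j)) (hbap : ∀ i j, APfun T (b i j))
    (hIap : ∀ i, APfun T (I i)) (x : ℝ → Fin n → ℝ) (hxc : ContinuousOn x T)
    (hx : ∀ t ∈ T, ‖x t‖ ≤ r0)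
    (hd : ∀ t ∈ T, ∀ i, deltaDeriv T (fun s => x s i) t (cnnN c a b f γ I x t i)) :
    APfun T x := by
  have hT := H.hT
  have hr0 := H.hr0
  have hqc := H.hqc
  refine ⟨hxc, fun ε hε => ?_⟩
  set F : ℝ := 1 + ∑ j, (|f j 0| + α j * r0) with hF
  have hterm : ∀ j, 0 ≤ |f j 0| + α j * r0 := fun j => by
    have := H.hα j
    positivity
  have hF1 : 1 ≤ F := by
    have : 0 ≤ ∑ j, (|f j 0| + α j * r0) := Finset.sum_nonneg fun j _ => hterm j
    linarith
  have hFb : ∀ j z, |z| ≤ r0 → |f j z| ≤ F := by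
    intro j z hz
    have h1 := H.hlip j z 0
    rw [sub_zero] at h1
    have h2 := mul_le_mul_of_nonneg_left hz (H.hα j).le
    have h3 := abs_sub_abs_le_abs_sub (f j z) (f j 0)
    have h4 := Finset.single_le_sum (f := fun j => |f j 0| + α j * r0)
      (fun j _ => hterm j) (Finset.mem_univ j)
    linarith
  have hab : ∀ s ∈ T, ∀ j, |f j (x s j)| ≤ F := fun s hs j =>
    hFb j _ ((norm_le_pi_norm (x s) j).trans (hx s hs))
  have hden : 0 < (2 * n + 1) * F + r0 := by positivity
  have hcq : 0 < c0 - q := by linarith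
  set e : ℝ := ε * (c0 - q) / (2 * ((2 * n + 1) * F + r0)) with he
  have he0 : 0 < e := by positivity
  have heE : ((2 * n + 1) * (e * F) + e * r0) / (c0 - q) = ε / 2 := by
    rw [he]; field_simp
  obtain ⟨l, hl, hjoint⟩ := ap_joint hT
    (g := (Sum.elim (Sum.elim c I) (Sum.elim (fun p : Fin n × Fin n => a p.1 p.2)
      (fun p : Fin n × Fin n => b p.1 p.2)) :
      (Fin n ⊕ Fin n) ⊕ ((Fin n × Fin n) ⊕ (Fin n × Fin n)) → ℝ → ℝ))
    (by
      rintro ((i | i) | (p | p))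
      · exact hcap i
      · exact hIap i
      · exact haap p.1 p.2
      · exact hbap p.1 p.2) e he0
  refine ⟨l, hl, fun y => ?_⟩
  obtain ⟨τ, hτ, hτy, hap⟩ := hjoint y
  refine ⟨τ, hτ, hτy, ?_⟩
  have hc' : ∀ i, ∀ t ∈ T, |c i (t + τ) - c i t| < e := fun i => hap (Sum.inl (Sum.inl i))
  have hI' : ∀ i, ∀ t ∈ T, |I i (t + τ) - I i t| < e := fun i => hap (Sum.inl (Sum.inr i))
  have ha' : ∀ i j, ∀ t ∈ T, |a i j (t + τ) - a i j t| < e :=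
    fun i j => hap (Sum.inr (Sum.inl (i, j)))
  have hb' : ∀ i j, ∀ t ∈ T, |b i j (t + τ) - b i j t| < e :=
    fun i j => hap (Sum.inr (Sum.inr (i, j)))
  have hmap : ∀ t ∈ T, t + τ ∈ T := fun t ht => (hτ t ht).1
  have key := H.diff (fun t => x (t + τ) - x t)
    (fun t i => cnnG a b f γ I x (t + τ) i - cnnG a b f γ I x t i
      - (c i (t + τ) - c i t) * x (t + τ) i) (2 * r0) ((2 * n + 1) * (e * F) + e * r0)
    (by positivity)
    ((hxc.comp (by fun_prop) hmap).sub hxc)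
    (fun t ht => by
      have h1 := hx t ht
      have h2 := hx _ (hmap t ht)
      have := norm_sub_le (x (t + τ)) (x t)
      linarith)
    (fun t ht i => by
      have h1 := deltaDeriv_shift hT hτ (hd _ (hmap t ht) i)
      have h2 := deltaDeriv_sub h1 (hd t ht i)
      convert h2 using 1
      all_goals simp only [cnnN, Pi.sub_apply]
      ring)
    (fun M hM hzM t ht i => by
      have k1 := H.G_est x x t (t + τ) M (e * F) ht hM i (hzM t ht)
        (fun j => by
          have := hzM _ ((H.hγ i j).1 t ht).2
          rwa [show t - γ i j + τ = t + τ - γ i j by ring] at this)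
        (fun j => mul_le_mul (ha' i j t ht).le (hab _ (hmap t ht) j) (abs_nonneg _) he0.le)
        (fun j => mul_le_mul (hb' i j t ht).le
          (hab _ ((H.hγ i j).1 _ (hmap t ht)).2 j) (abs_nonneg _) he0.le)
        ((hI' i t ht).le.trans (le_mul_of_one_le_right he0.le hF1))
      have k2 : |(c i (t + τ) - c i t) * x (t + τ) i| ≤ e * r0 := by
        rw [abs_mul]
        exact mul_le_mul (hc' i t ht).le
          ((norm_le_pi_norm (x (t + τ)) i).trans (hx _ (hmap t ht))) (abs_nonneg _) he0.le
      have k3 := abs_sub (cnnG a b f γ I x (t + τ) i - cnnG a b f γ I x t i)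
        ((c i (t + τ) - c i t) * x (t + τ) i)
      linarith)
  intro t ht
  have := key t ht
  rw [heE] at this
  linarith

end

/-- Existence and uniqueness of an almost periodic solution of the delayed
cellular neural network `x_i^Δ = −c_i x_i + Σ_j a_{ij} f_j(x_j(t)) + Σ_j b_{ij} f_j(x_j(t−γ_{ij})) + I_i`
in `E = {φ ∈ AP(T,ℝⁿ) : ‖φ‖_∞ ≤ r₀}` under hypotheses (H1)–(H3), (H5), with almost periodic inputs. -/
theorem cnn_ap_solution {n : ℕ} (T : Set ℝ) (hT : APTimeScale T)
    (hgrain : ∃ M : ℝ, ∀ t ∈ T, tsGrain T t ≤ M)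
    (c : Fin n → ℝ → ℝ) (a b : Fin n → Fin n → ℝ → ℝ)
    (f : Fin n → ℝ → ℝ) (γ : Fin n → Fin n → ℝ) (I : Fin n → ℝ → ℝ)
    (α : Fin n → ℝ) (r0 : ℝ) (hr0 : 0 < r0)
    -- (H1)
    (hfc : ∀ j, Continuous (f j)) (hα : ∀ j, 0 < α j)
    (hlip : ∀ j, ∀ x y : ℝ, |f j x - f j y| ≤ α j * |x - y|)
    -- (H2)
    (hcap : ∀ i, APfun T (c i)) (haap : ∀ i j, APfun T (a i j)) (hbap : ∀ i j, APfun T (b i j))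
    -- (H3)
    (hcinf : ∀ i, 0 < sInf (c i '' T))
    (hreg : ∀ i, ∀ t ∈ T, 0 < 1 - tsGrain T t * c i t)
    (hγ : ∀ i j, γ i j ∈ tsPi T ∧ 0 ≤ γ i j)
    -- (H4)
    (hI : ∀ i, APfun T (I i))
    -- (H5) : max_i Π_i < min_i c̲_i
    (hPi : ∀ i i' : Fin n,
      (∑ j, (sSup ((fun t => |a i j t|) '' T) + sSup ((fun t => |b i j t|) '' T)) * α j)
        < sInf (c i' '' T))
    -- (H5) : max_i (η_i / c̲_i) + L ≤ r₀
    (hr : ∀ i i' : Fin n,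
      (∑ j, (sSup ((fun t => |a i j t|) '' T) + sSup ((fun t => |b i j t|) '' T))
          * (|f j 0| + α j * r0)) / sInf (c i '' T)
        + sSup ((fun t => |I i' t|) '' T) / sInf (c i' '' T) ≤ r0) :
    ∃ x : ℝ → Fin n → ℝ,
      (APfun T x ∧ (∀ t ∈ T, ‖x t‖ ≤ r0) ∧ IsCNNSol T T c a b f γ I x) ∧
      ∀ y : ℝ → Fin n → ℝ,
        (APfun T y ∧ (∀ t ∈ T, ‖y t‖ ≤ r0) ∧ IsCNNSol T T c a b f γ I y) →
        ∀ t ∈ T, y t = x t := by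
  have hbddA : ∀ g : ℝ → ℝ, APfun T g → ∀ t ∈ T, |g t| ≤ sSup ((fun t => |g t|) '' T) := by
    intro g hg t ht
    obtain ⟨K, _, hK⟩ := ap_bdd hT hg
    exact le_csSup ⟨K, by rintro _ ⟨s, hs, rfl⟩; exact hK s hs⟩ ⟨t, ht, rfl⟩
  have hcl : ∀ i, ∀ t ∈ T, sInf (c i '' T) ≤ c i t := by
    intro i t ht
    obtain ⟨K, _, hK⟩ := ap_bdd hT (hcap i)
    exact csInf_le ⟨-K, by rintro _ ⟨s, hs, rfl⟩; exact (abs_le.mp (hK s hs)).1⟩ ⟨t, ht, rfl⟩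
  obtain ⟨C, hC0, hC⟩ : ∃ C, 0 ≤ C ∧ ∀ i, ∀ t ∈ T, c i t ≤ C := by
    choose K hK0 hK using fun i => ap_bdd hT (hcap i)
    refine ⟨∑ i, K i, Finset.sum_nonneg fun i _ => hK0 i, fun i t ht => ?_⟩
    exact (le_abs_self _).trans ((hK i t ht).trans
      (Finset.single_le_sum (fun i _ => hK0 i) (Finset.mem_univ i)))
  obtain ⟨t1, ht1⟩ := hT.1
  obtain ⟨q, c0, hq0, hqc, hc0, hq⟩ : ∃ q c0 : ℝ, 0 ≤ q ∧ q < c0 ∧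
      (∀ i, c0 ≤ sInf (c i '' T)) ∧
      ∀ i, ∑ j, (sSup ((fun t => |a i j t|) '' T) + sSup ((fun t => |b i j t|) '' T)) * α j
        ≤ q := by
    by_cases hn : Nonempty (Fin n)
    · obtain ⟨i1, hi1⟩ := Finite.exists_max (fun i =>
        ∑ j, (sSup ((fun t => |a i j t|) '' T) + sSup ((fun t => |b i j t|) '' T)) * α j)
      obtain ⟨i2, hi2⟩ := Finite.exists_min (fun i => sInf (c i '' T))
      refine ⟨_, _, ?_, hPi i1 i2, hi2, hi1⟩
      refine Finset.sum_nonneg fun j _ => mul_nonneg (add_nonneg ?_ ?_) (hα j).le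
      · exact (abs_nonneg _).trans (hbddA _ (haap i1 j) t1 ht1)
      · exact (abs_nonneg _).trans (hbddA _ (hbap i1 j) t1 ht1)
    · exact ⟨0, 1, le_rfl, one_pos, fun i => (hn ⟨i⟩).elim, fun i => (hn ⟨i⟩).elim⟩
  have H : CNNHyp T c a b f γ I α r0 (fun i => sInf (c i '' T)) C
      (fun i j => sSup ((fun t => |a i j t|) '' T)) (fun i j => sSup ((fun t => |b i j t|) '' T))
      (fun i => sSup ((fun t => |I i t|) '' T)) q c0 :=
    { hT := hT, hr0 := hr0, hfc := hfc, hα := hα, hlip := hlip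
      cc := fun i => (hcap i).1
      ac := fun i j => (haap i j).1
      bc := fun i j => (hbap i j).1
      Ic := fun i => (hI i).1
      hreg := hreg, hγ := hγ, hc := hcl, hC0 := hC0, hC := hC
      ha := fun i j => hbddA _ (haap i j)
      hb := fun i j => hbddA _ (hbap i j)
      hI := fun i => hbddA _ (hI i)
      hq0 := hq0, hqc := hqc, hcl := hc0, hq := hq
      hr := fun i => by
        have h := hr i i
        rw [← add_div, div_le_iff₀ (hcinf i)] at h
        exact h }
  have hexpr : ∀ (x : ℝ → Fin n → ℝ) t i, (-(c i t) * x t i + (∑ j, a i j t * f j (x t j)) +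
      (∑ j, b i j t * f j (x (t - γ i j) j)) + I i t) = cnnN c a b f γ I x t i := by
    intro x t i
    unfold cnnN cnnG
    ring
  obtain ⟨x, hxc, hxb, hxd⟩ := H.entire
  refine ⟨x, ⟨H.sol_ap hcap haap hbap hI x hxc hxb hxd, hxb, hxc, fun t ht i => ?_⟩, ?_⟩
  · rw [hexpr]; exact hxd t ht i
  · rintro y ⟨_, hyb, hyc, hyd⟩ t ht
    have key := H.diff (fun t => y t - x t)
      (fun t i => cnnG a b f γ I y t i - cnnG a b f γ I x t i) (2 * r0) 0 le_rfl
      (hyc.sub hxc)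
      (fun t ht => by
        have h1 := hxb t ht
        have h2 := hyb t ht
        have := norm_sub_le (y t) (x t)
        linarith)
      (fun t ht i => by
        have h1 := hyd t ht i
        rw [hexpr] at h1
        have h2 := deltaDeriv_sub h1 (hxd t ht i)
        convert h2 using 1
        all_goals simp only [cnnN, Pi.sub_apply]
        ring)
      (fun M hM hzM t ht i => by
        have k1 := H.G_est y x t t M 0 ht hM i (hzM t ht)
          (fun j => hzM _ ((H.hγ i j).1 t ht).2) (by simp) (by simp) (by simp)
        simpa using k1) t ht
    rw [zero_div] at key
    exact sub_eq_zero.mp (norm_le_zero_iff.mp key)
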